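/- Let T > 0, let u : ℝ² × [0,T] → ℝ² be twice continuously differentiable, let R, S > 0 and set α = 1/(RS) and γ = (1/R)·√(3/S), and let y₀, v₀ ∈ ℝ². Suppose q : [0,∞) × [0,T] → ℝ² is bounded, continuous on ((0,∞) × [0,T]) ∪ ({0} × (0,T]), smooth on (0,∞) × (0,T] where it satisfies the heat equation ∂ₜq = ∂ₓₓq; q(x,0) = 0 for all x > 0; the one-sided derivative ∂ₓq(0,t) exists for t ∈ (0,T]; t ↦ q(0,t) is continuously differentiable on (0,T] with lim_{t→0⁺} q(0,t) = v₀ - u(y₀,0); y : [0,T] → ℝ² is continuously differentiable with y(0) = y₀ and y'(t) = q(0,t) + u(y(t),t); and the nonlinear boundary condition ∂ₜq(0,t) + α·q(0,t) - γ·∂ₓq(0,t) = (1/R - 1)·( ∂ₜu + (u·∇)u )(y(t),t) - ( q(0,t)·∇ )u(y(t),t) holds for all t ∈ (0,T]. Then the function v(t) := q(0,t) + u(y(t),t) satisfies, for every t ∈ (0,T], the Maxey–Riley equation R·v'(t) = ( ∂ₜu + (u·∇)u )(y(t),t) - (1/S)·( v(t) - u(y(t),t) ) - √(3/(πS))·(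 ( v₀ - u(y₀,0) )/√t + ∫₀ᵗ ( v'(s) - d/ds[u(y(s),s)] )/√(t-s) ds ), together with y'(t) = v(t). -/

import Mathlib

open MeasureTheory Filter intervalIntegral
open scoped Topology

/-- `g` is twice differentiable at `x`, with second derivative `d`. -/
def HasSndDerivAt (g : ℝ → ℝ) (d x : ℝ) : Prop :=
  ∃ g' : ℝ → ℝ, (∀ᶠ ξ in 𝓝 x, HasDerivAt g (g' ξ) ξ) ∧ HasDerivAt g' d x

theorem HasSndDerivAt.sub {g h : ℝ → ℝ} {d e x : ℝ} (hg : HasSndDerivAt g d x)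
    (hh : HasSndDerivAt h e x) : HasSndDerivAt (fun ξ => g ξ - h ξ) (d - e) x := by
  obtain ⟨g', hg, hg'⟩ := hg
  obtain ⟨h', hh, hh'⟩ := hh
  refine ⟨fun ξ => g' ξ - h' ξ, ?_, hg'.sub hh'⟩
  filter_upwards [hg, hh] with ξ h1 h2 using h1.sub h2

theorem hasSndDerivAt_quadratic (a b c x : ℝ) :
    HasSndDerivAt (fun ξ => a + b * ξ + c * ξ ^ 2) (2 * c) x := by
  refine ⟨fun ξ => b + 2 * c * ξ, Eventually.of_forall fun ξ => ?_, ?_⟩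
  · have := (((hasDerivAt_id ξ).const_mul b).const_add a).add
      (((hasDerivAt_id ξ).pow 2).const_mul c)
    refine this.congr_deriv ?_
    simp; ring
  · have := ((hasDerivAt_id x).const_mul (2 * c)).const_add b
    exact this.congr_deriv (by simp)

theorem HasSndDerivAt.nonpos_of_isLocalMax {g : ℝ → ℝ} {d x : ℝ} (hg : HasSndDerivAt g d x)
    (hmax : IsLocalMax g x) : d ≤ 0 := by
  obtain ⟨g', hg, hg'⟩ := hg
  by_contra! hd
  have hder : deriv g =ᶠ[𝓝 x] g' := hg.mono fun ξ h => h.deriv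
  have hdd : deriv (deriv g) x = d := by rw [hder.deriv_eq, hg'.deriv]
  have hmin : IsLocalMin g x :=
    isLocalMin_of_deriv_deriv_pos (by rw [hdd]; exact hd) hmax.deriv_eq_zero
      hg.self_of_nhds.continuousAt
  have hconst : g =ᶠ[𝓝 x] fun _ => g x := by
    filter_upwards [hmax, hmin] with ξ h1 h2 using le_antisymm h1 h2
  have : deriv (deriv g) x = 0 := by
    rw [hconst.deriv.deriv_eq]; simp
  linarith

theorem nonneg_deriv_of_isMax_left {g : ℝ → ℝ} {a t d : ℝ} (hat : a < t)
    (hg : HasDerivWithinAt g d (Set.Icc a t) t) (hmax : ∀ s ∈ Set.Icc a t, g s ≤ g t) :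
    0 ≤ d := by
  have h1 : Tendsto (slope g t) (𝓝[Set.Ioo a t] t) (𝓝 d) := by
    have := (hg.mono Set.Ioo_subset_Icc_self)
    rw [hasDerivWithinAt_iff_tendsto_slope' (by simp)] at this
    exact this
  have hne : (𝓝[Set.Ioo a t] t).NeBot := right_nhdsWithin_Ioo_neBot hat
  refine ge_of_tendsto h1 ?_
  filter_upwards [self_mem_nhdsWithin] with s hs
  rw [slope_def_field]
  exact div_nonneg_of_nonpos (by linarith [hmax s ⟨hs.1.le, hs.2.le⟩]) (by linarith [hs.2])

/-- Weak maximum principle for strict subsolutions of the heat equation on a rectangle. -/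
theorem heat_maximum_principle {w : ℝ → ℝ → ℝ} {L a b : ℝ}
    (hc : ContinuousOn (fun p : ℝ × ℝ => w p.1 p.2) (Set.Icc 0 L ×ˢ Set.Icc a b))
    (hw : ∀ x ∈ Set.Ioo 0 L, ∀ t ∈ Set.Ioc a b, ∃ d e : ℝ,
      HasDerivWithinAt (w x) d (Set.Icc a t) t ∧ HasSndDerivAt (fun ξ => w ξ t) e x ∧ d < e)
    (hbot : ∀ x ∈ Set.Icc 0 L, w x a ≤ 0)
    (hleft : ∀ t ∈ Set.Icc a b, w 0 t ≤ 0) (hright : ∀ t ∈ Set.Icc a b, w L t ≤ 0) :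
    ∀ x ∈ Set.Icc 0 L, ∀ t ∈ Set.Icc a b, w x t ≤ 0 := by
  intro x hx t ht
  obtain ⟨⟨x₀, t₀⟩, ⟨hx₀, ht₀⟩, hmax⟩ :=
    (isCompact_Icc.prod isCompact_Icc).exists_isMaxOn ⟨(x, t), hx, ht⟩ hc
  simp only at hx₀ ht₀
  have hM : ∀ ξ ∈ Set.Icc 0 L, ∀ s ∈ Set.Icc a b, w ξ s ≤ w x₀ t₀ := fun ξ hξ s hs =>
    hmax (Set.mk_mem_prod hξ hs)
  refine (hM x hx t ht).trans ?_
  by_contra! hpos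
  have hxl : 0 < x₀ := lt_of_le_of_ne hx₀.1 fun h => by
    subst h; exact absurd (hleft t₀ ht₀) (not_le.2 hpos)
  have hxr : x₀ < L := lt_of_le_of_ne hx₀.2 fun h => by
    subst h; exact absurd (hright t₀ ht₀) (not_le.2 hpos)
  have htl : a < t₀ := lt_of_le_of_ne ht₀.1 fun h => by
    subst h; exact absurd (hbot x₀ hx₀) (not_le.2 hpos)
  obtain ⟨d, e, hd, he, hde⟩ := hw x₀ ⟨hxl, hxr⟩ t₀ ⟨htl, ht₀.2⟩
  have h1 : 0 ≤ d := nonneg_deriv_of_isMax_left htl hd fun s hs =>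
    hM x₀ hx₀ s ⟨hs.1, hs.2.trans ht₀.2⟩
  have h2 : e ≤ 0 := he.nonpos_of_isLocalMax <| by
    filter_upwards [Ioo_mem_nhds hxl hxr] with ξ hξ
    exact hM ξ ⟨hξ.1.le, hξ.2.le⟩ t₀ ht₀
  linarith

/-- A bounded solution of the heat equation on the half line that is continuous up to the parabolic
boundary and vanishes there is nonpositive. -/
theorem heat_half_line_nonpos {z : ℝ → ℝ → ℝ} {T M : ℝ}
    (hc : ContinuousOn (fun p : ℝ × ℝ => z p.1 p.2) (Set.Ici 0 ×ˢ Set.Icc 0 T))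
    (hz : ∀ x > 0, ∀ t ∈ Set.Ioc 0 T, ∃ d : ℝ,
      HasDerivWithinAt (z x) d (Set.Icc 0 t) t ∧ HasSndDerivAt (fun ξ => z ξ t) d x)
    (hbdd : ∀ x ≥ 0, ∀ t ∈ Set.Icc 0 T, z x t ≤ M)
    (hbot : ∀ x ≥ 0, z x 0 = 0) (hleft : ∀ t ∈ Set.Icc 0 T, z 0 t = 0) :
    ∀ x ≥ 0, ∀ t ∈ Set.Icc 0 T, z x t ≤ 0 := by
  intro x hx t ht
  have key : ∀ L > x, z x t ≤ (|M| * (x ^ 2 + 3 * t)) / L ^ 2 := by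
    intro L hL
    have hL0 : 0 < L := by linarith
    suffices h : ∀ η > |M| / L ^ 2, z x t ≤ η * (x ^ 2 + 3 * t) by
      have h1 : Tendsto (fun η : ℝ => η * (x ^ 2 + 3 * t)) (𝓝[>] (|M| / L ^ 2))
          (𝓝 (|M| / L ^ 2 * (x ^ 2 + 3 * t))) :=
        ((continuous_id.mul continuous_const).tendsto _).mono_left nhdsWithin_le_nhds
      have h2 := ge_of_tendsto h1 (by filter_upwards [self_mem_nhdsWithin] with η hη using h η hη)
      exact h2.trans_eq (by ring)
    intro η hη'
    have hη0 : 0 < η := by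
      have : 0 ≤ |M| / L ^ 2 := by positivity
      linarith
    have hML : M ≤ η * L ^ 2 := by
      have := (div_lt_iff₀ (by positivity)).1 hη'
      linarith [le_abs_self M]
    have := heat_maximum_principle (w := fun x t => z x t - (3 * η * t + 0 * x + η * x ^ 2))
      (L := L) (a := 0) (b := T) ?_ ?_ ?_ ?_ ?_ x ⟨hx, hL.le⟩ t ht
    · linarith
    · refine (hc.mono (Set.prod_mono Set.Icc_subset_Ici_self subset_rfl)).sub ?_
      fun_prop
    · intro x hx t ht
      obtain ⟨d, hd, hd'⟩ := hz x hx.1 t ht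
      refine ⟨d - 3 * η, d - 2 * η, ?_, hd'.sub (hasSndDerivAt_quadratic _ _ _ _), by linarith⟩
      have h3 : HasDerivAt (fun t : ℝ => 3 * η * t + 0 * x + η * x ^ 2) (3 * η) t := by
        have := (((hasDerivAt_id t).const_mul (3 * η)).add_const (0 * x)).add_const (η * x ^ 2)
        exact this.congr_deriv (by simp)
      exact hd.sub h3.hasDerivWithinAt
    · intro x hx
      simp only [hbot x hx.1]
      nlinarith [sq_nonneg x]
    · intro t ht
      simp only [hleft t ht]
      nlinarith [ht.1]
    · intro t ht
      have := hbdd L hL0.le t ht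
      have h4 := mul_nonneg hη0.le ht.1
      linarith
  have hlim : Tendsto (fun L : ℝ => (|M| * (x ^ 2 + 3 * t)) / L ^ 2) atTop (𝓝 0) :=
    tendsto_const_nhds.div_atTop (tendsto_pow_atTop two_ne_zero)
  exact ge_of_tendsto hlim (by filter_upwards [eventually_gt_atTop x] with L hL using key L hL)

theorem heat_half_line_unique {z : ℝ → ℝ → ℝ} {T M : ℝ}
    (hc : ContinuousOn (fun p : ℝ × ℝ => z p.1 p.2) (Set.Ici 0 ×ˢ Set.Icc 0 T))
    (hz : ∀ x > 0, ∀ t ∈ Set.Ioc 0 T, ∃ d : ℝ,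
      HasDerivWithinAt (z x) d (Set.Icc 0 t) t ∧ HasSndDerivAt (fun ξ => z ξ t) d x)
    (hbdd : ∀ x ≥ 0, ∀ t ∈ Set.Icc 0 T, |z x t| ≤ M)
    (hbot : ∀ x ≥ 0, z x 0 = 0) (hleft : ∀ t ∈ Set.Icc 0 T, z 0 t = 0) :
    ∀ x ≥ 0, ∀ t ∈ Set.Icc 0 T, z x t = 0 := by
  intro x hx t ht
  refine le_antisymm (heat_half_line_nonpos hc hz (fun x hx t ht => (abs_le.1 (hbdd x hx t ht)).2)
    hbot hleft x hx t ht) ?_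
  have := heat_half_line_nonpos (z := fun x t => - z x t) (M := M) hc.neg ?_
    (fun x hx t ht => by linarith [(abs_le.1 (hbdd x hx t ht)).1])
    (fun x hx => by simp [hbot x hx]) (fun t ht => by simp [hleft t ht]) x hx t ht
  · linarith
  · intro x hx t ht
    obtain ⟨d, hd, g', hg, hg'⟩ := hz x hx t ht
    exact ⟨-d, hd.neg, fun ξ => - g' ξ, hg.mono fun ξ h => h.neg, hg'.neg⟩

theorem intervalIntegrable_of_continuousOn_bounded {f : ℝ → ℝ} {T C a b : ℝ}
    (hf : ContinuousOn f (Set.Ioc 0 T)) (hC : ∀ t ∈ Set.Ioc 0 T, |f t| ≤ C)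
    (ha : a ∈ Set.Icc 0 T) (hb : b ∈ Set.Icc 0 T) : IntervalIntegrable f volume a b := by
  have h : IntegrableOn f (Set.Ioc 0 T) :=
    IntegrableOn.of_bound (by simp) (hf.aestronglyMeasurable measurableSet_Ioc) C
      ((ae_restrict_iff' measurableSet_Ioc).2 (Eventually.of_forall hC))
  rw [intervalIntegrable_iff]
  refine h.mono_set fun s hs => ?_
  rw [Set.uIoc, Set.mem_Ioc] at hs
  exact ⟨(le_min ha.1 hb.1).trans_lt hs.1, hs.2.trans (max_le ha.2 hb.2)⟩

/-- A bounded solution `q` of the heat equation on the half line with zero initial data, with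
first and second space derivatives `p` and `r`; no regularity is assumed at the corner `(0, 0)`. -/
structure HeatSolution (T C : ℝ) (q p r : ℝ → ℝ → ℝ) : Prop where
  bdd : ∀ x ≥ 0, ∀ t ∈ Set.Icc 0 T, |q x t| ≤ C
  cont : ContinuousOn (fun z : ℝ × ℝ => q z.1 z.2)
    ((Set.Ioi 0 ×ˢ Set.Icc 0 T) ∪ ({0} ×ˢ Set.Ioc 0 T))
  cont_x : ContinuousOn (fun z : ℝ × ℝ => p z.1 z.2) (Set.Ioi 0 ×ˢ Set.Ioc 0 T)
  cont_xx : ContinuousOn (fun z : ℝ × ℝ => r z.1 z.2) (Set.Ioi 0 ×ˢ Set.Ioc 0 T)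
  deriv_x : ∀ x > 0, ∀ t ∈ Set.Ioc 0 T, HasDerivAt (fun ξ => q ξ t) (p x t) x
  deriv_xx : ∀ x > 0, ∀ t ∈ Set.Ioc 0 T, HasDerivAt (fun ξ => p ξ t) (r x t) x
  deriv_t : ∀ x > 0, ∀ t ∈ Set.Ioc 0 T, HasDerivWithinAt (q x) (r x t) (Set.Ioc 0 T) t
  initial : ∀ x > 0, q x 0 = 0

namespace HeatSolution

variable {T C : ℝ} {q p r : ℝ → ℝ → ℝ}

theorem hasSndDerivAt (h : HeatSolution T C q p r) {x t : ℝ} (hx : 0 < x)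
    (ht : t ∈ Set.Ioc 0 T) : HasSndDerivAt (fun ξ => q ξ t) (r x t) x :=
  ⟨fun ξ => p ξ t, by filter_upwards [Ioi_mem_nhds hx] with ξ hξ using h.deriv_x ξ hξ t ht,
    h.deriv_xx x hx t ht⟩

theorem continuousOn_time (h : HeatSolution T C q p r) {x : ℝ} (hx : 0 < x) :
    ContinuousOn (q x) (Set.Icc 0 T) :=
  h.cont.comp (f := fun t => (x, t)) (by fun_prop) fun _ ht => Or.inl ⟨hx, ht⟩

theorem continuousOn_closed (h : HeatSolution T C q p r) :
    ContinuousOn (fun z : ℝ × ℝ => q z.1 z.2) (Set.Ici 0 ×ˢ Set.Ioc 0 T) := by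
  refine h.cont.mono fun z hz => ?_
  rcases eq_or_lt_of_le (show 0 ≤ z.1 from hz.1) with h0 | h0
  · exact Or.inr ⟨h0.symm, hz.2⟩
  · exact Or.inl ⟨h0, Set.Ioc_subset_Icc_self hz.2⟩

theorem continuousOn_time' (h : HeatSolution T C q p r) {x : ℝ} (hx : 0 ≤ x) :
    ContinuousOn (q x) (Set.Ioc 0 T) :=
  h.continuousOn_closed.comp (f := fun t => (x, t)) (by fun_prop) fun _ ht => ⟨hx, ht⟩

theorem continuousOn_space (h : HeatSolution T C q p r) {t : ℝ} (ht : t ∈ Set.Ioc 0 T) :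
    ContinuousOn (fun x => q x t) (Set.Ici 0) :=
  h.continuousOn_closed.comp (f := fun x => (x, t)) (by fun_prop) fun _ hx => ⟨hx, ht⟩

theorem bdd' (h : HeatSolution T C q p r) {x : ℝ} (hx : 0 ≤ x) :
    ∀ t ∈ Set.Ioc 0 T, |q x t| ≤ C := fun t ht => h.bdd x hx t (Set.Ioc_subset_Icc_self ht)

theorem intervalIntegrable (h : HeatSolution T C q p r) {x : ℝ} (hx : 0 ≤ x) {a b : ℝ}
    (ha : a ∈ Set.Icc 0 T) (hb : b ∈ Set.Icc 0 T) : IntervalIntegrable (q x) volume a b :=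
  intervalIntegrable_of_continuousOn_bounded (h.continuousOn_time' hx) (h.bdd' hx) ha hb

theorem boundary_growth_aux (h : HeatSolution T C q p r) {df : ℝ → ℝ} {D δ σ s₀ : ℝ}
    (hδ : 0 < δ) (hs₀ : s₀ ∈ Set.Icc (2 * δ) T)
    (hdf : ∀ t ∈ Set.Ioc 0 T, HasDerivWithinAt (q 0) (df t) (Set.Ioc 0 T) t)
    (hD : ∀ t ∈ Set.Icc δ T, |df t| ≤ D) (hσ : |σ| = 1) {x : ℝ} (hx : x ∈ Set.Icc 0 1) :
    σ * (q x s₀ - q 0 s₀) ≤ (10 * (2 * C + 2 * C / δ) + D + 1) * x := by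
  have hC : 0 ≤ C := (abs_nonneg _).trans
    (h.bdd x hx.1 s₀ ⟨by linarith [hs₀.1], hs₀.2⟩)
  have hD0 : 0 ≤ D := (abs_nonneg _).trans (hD s₀ ⟨by linarith [hs₀.1], hs₀.2⟩)
  obtain ⟨A, hA⟩ : ∃ A, A = 2 * C + 2 * C / δ := ⟨_, rfl⟩
  obtain ⟨K, hK⟩ : ∃ K, K = (3 * A + D + 1) / 2 := ⟨_, rfl⟩
  have hA0 : 0 ≤ A := by rw [hA]; positivity
  have hAC : 2 * C ≤ A := by
    have : 0 ≤ 2 * C / δ := by positivity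
    linarith
  have hAδ : 2 * C ≤ A * δ := by
    have : A * δ = 2 * C * δ + 2 * C := by rw [hA]; field_simp
    have : 0 ≤ 2 * C * δ := by positivity
    linarith
  have hK0 : 0 ≤ K := by rw [hK]; positivity
  have hdiff : ∀ x ∈ Set.Icc (0 : ℝ) 1, ∀ t ∈ Set.Icc (s₀ - δ) s₀, σ * (q x t - q 0 t) ≤ 2 * C := by
    intro x hx t ht
    have ht' : t ∈ Set.Icc 0 T := ⟨by linarith [ht.1, hs₀.1], ht.2.trans hs₀.2⟩
    have h1 := h.bdd x hx.1 t ht'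
    have h2 := h.bdd 0 le_rfl t ht'
    calc σ * (q x t - q 0 t) ≤ |σ * (q x t - q 0 t)| := le_abs_self _
      _ = |q x t - q 0 t| := by rw [abs_mul, hσ, one_mul]
      _ ≤ |q x t| + |q 0 t| := abs_sub _ _
      _ ≤ 2 * C := by linarith
  have hsub : ∀ t ∈ Set.Icc (s₀ - δ) s₀, t ∈ Set.Ioc 0 T := fun t ht =>
    ⟨by linarith [ht.1, hs₀.1], ht.2.trans hs₀.2⟩
  have key := heat_maximum_principle
    (w := fun x t => σ * (q x t - q 0 t) - (A * (s₀ - t) + 2 * K * x + (A - K) * x ^ 2))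
    (L := 1) (a := s₀ - δ) (b := s₀) ?_ ?_ ?_ ?_ ?_ x hx s₀ ⟨by linarith, le_rfl⟩
  · have hx2 : x ^ 2 ≤ x := by nlinarith [hx.1, hx.2]
    simp only [sub_self, mul_zero, zero_add] at key
    have h1 : A * x ^ 2 ≤ A * x := mul_le_mul_of_nonneg_left hx2 hA0
    have h2 : 0 ≤ K * x ^ 2 := by positivity
    have h3 : 0 ≤ A * x := mul_nonneg hA0 hx.1
    have h4 : 2 * K * x = 3 * (A * x) + D * x + x := by rw [hK]; ring
    rw [← hA]
    linarith
  · refine ContinuousOn.sub (continuousOn_const.mul (ContinuousOn.sub ?_ ?_)) (by fun_prop)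
    · exact h.continuousOn_closed.mono fun z hz => ⟨hz.1.1, hsub _ hz.2⟩
    · exact (h.continuousOn_time' le_rfl).comp (f := fun z : ℝ × ℝ => z.2) (by fun_prop)
        fun z hz => hsub _ hz.2
  · intro x hx t ht
    have ht' := hsub t ⟨ht.1.le, ht.2⟩
    have hst : Set.Icc (s₀ - δ) t ⊆ Set.Ioc 0 T := fun s hs => hsub s ⟨hs.1, hs.2.trans ht.2⟩
    refine ⟨σ * (r x t - df t) - (-A), σ * r x t - 2 * (A - K), ?_, ?_, ?_⟩
    · refine HasDerivWithinAt.sub (HasDerivWithinAt.const_mul _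
        (((h.deriv_t x hx.1 t ht').sub (hdf t ht')).mono hst)) ?_
      have := ((((hasDerivAt_id t).const_sub s₀).const_mul A).add_const (2 * K * x)).add_const
        ((A - K) * x ^ 2)
      exact (this.congr_deriv (by simp)).hasDerivWithinAt
    · obtain ⟨g', hg, hg'⟩ := h.hasSndDerivAt hx.1 ht'
      exact HasSndDerivAt.sub ⟨fun ξ => σ * g' ξ,
        hg.mono fun ξ hξ => (hξ.sub_const _).const_mul σ, hg'.const_mul σ⟩
        (hasSndDerivAt_quadratic _ _ _ _)
    · have h1 : |σ * df t| ≤ D := by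
        rw [abs_mul, hσ, one_mul]
        exact hD t ⟨by linarith [ht.1, hs₀.1], ht'.2⟩
      have := (abs_le.1 h1).1
      rw [hK]
      linarith
  · intro x hx
    have h1 := hdiff x hx (s₀ - δ) ⟨le_rfl, by linarith⟩
    have hx2 : x ^ 2 ≤ x := by nlinarith [hx.1, hx.2]
    have h2 : 0 ≤ K * (2 * x - x ^ 2) := mul_nonneg hK0 (by linarith [hx.1])
    have h3 : 0 ≤ A * x ^ 2 := by positivity
    linarith
  · intro t ht
    have h1 : 0 ≤ A * (s₀ - t) := mul_nonneg hA0 (by linarith [ht.2])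
    simp only [sub_self]
    linarith
  · intro t ht
    have h1 : 0 ≤ A * (s₀ - t) := mul_nonneg hA0 (by linarith [ht.2])
    have h2 := hdiff 1 (by simp) t ht
    linarith

/-- Away from the initial time, `q x s` leaves its boundary value at most linearly in `x`. -/
theorem exists_boundary_growth (h : HeatSolution T C q p r) {df : ℝ → ℝ} {ε : ℝ} (hε : 0 < ε)
    (hdf : ∀ t ∈ Set.Ioc 0 T, HasDerivWithinAt (q 0) (df t) (Set.Ioc 0 T) t)
    (hdfc : ContinuousOn df (Set.Ioc 0 T)) :
    ∃ K, ∀ s ∈ Set.Icc ε T, ∀ x ∈ Set.Icc (0 : ℝ) 1, |q x s - q 0 s| ≤ K * x := by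
  obtain ⟨D, hD⟩ := isCompact_Icc.exists_bound_of_continuousOn
    (hdfc.mono fun t (ht : t ∈ Set.Icc (ε / 2) T) => ⟨by linarith [ht.1], ht.2⟩)
  refine ⟨10 * (2 * C + 2 * C / (ε / 2)) + D + 1, fun s hs x hx => abs_le.2 ⟨?_, ?_⟩⟩
  rotate_left
  · have := h.boundary_growth_aux (δ := ε / 2) (σ := 1) (s₀ := s) (by positivity)
      ⟨by linarith [hs.1], hs.2⟩ hdf hD (by simp) hx
    rwa [one_mul] at this
  · have := h.boundary_growth_aux (δ := ε / 2) (σ := -1) (s₀ := s) (by positivity)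
      ⟨by linarith [hs.1], hs.2⟩ hdf hD (by simp) hx
    linarith

end HeatSolution

theorem hasDerivWithinAt_integral_Iic {f : ℝ → ℝ} {T t : ℝ} (ht : t ∈ Set.Ioc 0 T)
    (hf : ContinuousOn f (Set.Ioc 0 T)) (hi : IntervalIntegrable f volume 0 t) :
    HasDerivWithinAt (fun τ => ∫ s in (0 : ℝ)..τ, f s) (f t) (Set.Iic t) t := by
  have hmem : Set.Ioc 0 T ∈ 𝓝[≤] t :=
    mem_of_superset (Ioc_mem_nhdsLE ht.1) (Set.Ioc_subset_Ioc_right ht.2)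
  refine integral_hasDerivWithinAt_right hi (s := Set.Iic t) (t := Set.Iic t) ?_ ?_
  · exact ⟨Set.Ioc 0 T, hmem, hf.aestronglyMeasurable measurableSet_Ioc⟩
  · exact (hf t ht).mono_of_mem_nhdsWithin hmem

theorem hasDerivAt_integral_of_continuousOn {φ φ' : ℝ → ℝ → ℝ} {T a b x : ℝ}
    (ha : 0 < a) (hab : a ≤ b) (hb : b ≤ T) (hx : 0 < x)
    (hφ : ContinuousOn (fun z : ℝ × ℝ => φ z.1 z.2) (Set.Ioi 0 ×ˢ Set.Ioc 0 T))
    (hφ' : ContinuousOn (fun z : ℝ × ℝ => φ' z.1 z.2) (Set.Ioi 0 ×ˢ Set.Ioc 0 T))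
    (hd : ∀ x > 0, ∀ t ∈ Set.Ioc 0 T, HasDerivAt (fun ξ => φ ξ t) (φ' x t) x) :
    HasDerivAt (fun ξ => ∫ s in a..b, φ ξ s) (∫ s in a..b, φ' x s) x := by
  have hsub : Set.Icc a b ⊆ Set.Ioc 0 T := fun s hs => ⟨ha.trans_le hs.1, hs.2.trans hb⟩
  have hsec : ∀ {ψ : ℝ → ℝ → ℝ}, ContinuousOn (fun z : ℝ × ℝ => ψ z.1 z.2)
      (Set.Ioi 0 ×ˢ Set.Ioc 0 T) → ∀ ξ > 0, IntervalIntegrable (ψ ξ) volume a b := by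
    intro ψ hψ ξ hξ
    refine ContinuousOn.intervalIntegrable ?_
    rw [Set.uIcc_of_le hab]
    exact hψ.comp (f := fun s => (ξ, s)) (by fun_prop) fun s hs => ⟨hξ, hsub hs⟩
  obtain ⟨D, hD⟩ := (isCompact_Icc.prod isCompact_Icc).exists_bound_of_continuousOn
    (hφ'.mono (Set.prod_mono (fun ξ (hξ : ξ ∈ Set.Icc (x / 2) (2 * x)) =>
      show 0 < ξ by linarith [hξ.1]) hsub))
  refine (intervalIntegral.hasDerivAt_integral_of_dominated_loc_of_deriv_le
    (s := Set.Icc (x / 2) (2 * x)) (bound := fun _ => D)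
    (Icc_mem_nhds (by linarith) (by linarith)) ?_ (hsec hφ x hx)
    (hsec hφ' x hx).def'.1 ?_ intervalIntegrable_const ?_).2
  · filter_upwards [Ioi_mem_nhds hx] with ξ hξ using (hsec hφ ξ hξ).def'.1
  · refine Eventually.of_forall fun s hs ξ hξ => ?_
    rw [Set.uIoc_of_le hab] at hs
    exact hD (ξ, s) ⟨hξ, hs.1.le, hs.2⟩
  · refine Eventually.of_forall fun s hs ξ hξ => ?_
    rw [Set.uIoc_of_le hab] at hs
    exact hd ξ (by linarith [hξ.1]) s (hsub ⟨hs.1.le, hs.2⟩)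

theorem uIcc_one_subset_Ioi {x : ℝ} (hx : 0 < x) : Set.uIcc 1 x ⊆ Set.Ioi 0 := fun _ hs =>
  (lt_min one_pos hx).trans_le hs.1

theorem hasDerivAt_primitive_of_continuousOn_Ioi {m : ℝ → ℝ} (hm : ContinuousOn m (Set.Ioi 0))
    {x : ℝ} (hx : 0 < x) : HasDerivAt (fun w => ∫ z in (1 : ℝ)..w, m z) (m x) x :=
  integral_hasDerivAt_right (hm.mono (uIcc_one_subset_Ioi hx)).intervalIntegrable
    (hm.stronglyMeasurableAtFilter isOpen_Ioi x hx) (hm.continuousAt (Ioi_mem_nhds hx))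

theorem continuousOn_primitive_Ioi {m : ℝ → ℝ} (hm : ContinuousOn m (Set.Ioi 0)) :
    ContinuousOn (fun w => ∫ z in (1 : ℝ)..w, m z) (Set.Ioi 0) := fun _ hx =>
  (hasDerivAt_primitive_of_continuousOn_Ioi hm hx).continuousAt.continuousWithinAt

theorem eq_double_primitive {g g' m : ℝ → ℝ} (hm : ContinuousOn m (Set.Ioi 0))
    (hg : ∀ x > 0, HasDerivAt g (g' x) x) (hg' : ∀ x > 0, HasDerivAt g' (m x) x)
    {x : ℝ} (hx : 0 < x) :
    g x = g 1 + (x - 1) * (g 2 - g 1 - ∫ w in (1 : ℝ)..2, ∫ z in (1 : ℝ)..w, m z)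
      + ∫ w in (1 : ℝ)..x, ∫ z in (1 : ℝ)..w, m z := by
  have h1 : ∀ w > 0, g' w = g' 1 + ∫ z in (1 : ℝ)..w, m z := fun w hw => by
    rw [integral_eq_sub_of_hasDerivAt (fun z hz => hg' z (uIcc_one_subset_Ioi hw hz))
      (hm.mono (uIcc_one_subset_Ioi hw)).intervalIntegrable]
    ring
  have h2 : ∀ x > 0, g x = g 1 + (x - 1) * g' 1 + ∫ w in (1 : ℝ)..x, ∫ z in (1 : ℝ)..w, m z := by
    intro x hx
    have hi := ((continuousOn_primitive_Ioi hm).mono (uIcc_one_subset_Ioi hx)).intervalIntegrable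
      (μ := volume)
    have h3 := integral_eq_sub_of_hasDerivAt
      (f' := fun w => g' 1 + ∫ z in (1 : ℝ)..w, m z) (a := 1) (b := x) (f := g)
      (fun w hw => by
        rw [← h1 w (uIcc_one_subset_Ioi hx hw)]
        exact hg w (uIcc_one_subset_Ioi hx hw))
      (intervalIntegrable_const.add hi)
    rw [intervalIntegral.integral_add intervalIntegrable_const hi,
      intervalIntegral.integral_const, smul_eq_mul] at h3
    linarith
  have h4 := h2 2 two_pos
  rw [h2 x hx]
  have h5 : g' 1 = g 2 - g 1 - ∫ w in (1 : ℝ)..2, ∫ z in (1 : ℝ)..w, m z := by linarith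
  rw [h5]

namespace HeatSolution

variable {T C : ℝ} {q p r : ℝ → ℝ → ℝ}

theorem hasDerivWithinAt_integral (h : HeatSolution T C q p r) {x t : ℝ} (hx : 0 < x)
    (ht : t ∈ Set.Ioc 0 T) :
    HasDerivWithinAt (fun τ => ∫ s in (0 : ℝ)..τ, q x s) (q x t) (Set.Icc 0 t) t :=
  (hasDerivWithinAt_integral_Iic ht (h.continuousOn_time' hx.le)
    (h.intervalIntegrable hx.le ⟨le_rfl, ht.1.le.trans ht.2⟩
      ⟨ht.1.le, ht.2⟩)).mono Set.Icc_subset_Iic_self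

theorem abs_integral_le (h : HeatSolution T C q p r) {x a b : ℝ} (hx : 0 ≤ x)
    (ha : a ∈ Set.Icc 0 T) (hb : b ∈ Set.Icc 0 T) : |∫ s in a..b, q x s| ≤ C * |b - a| := by
  rw [← Real.norm_eq_abs]
  refine norm_integral_le_of_norm_le_const fun s hs => h.bdd' hx s ?_
  exact ⟨(le_min ha.1 hb.1).trans_lt hs.1, hs.2.trans (max_le ha.2 hb.2)⟩

theorem continuousOn_integral (h : HeatSolution T C q p r) :
    ContinuousOn (fun z : ℝ × ℝ => ∫ s in (0 : ℝ)..z.2, q z.1 s) (Set.Ici 0 ×ˢ Set.Icc 0 T) := by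
  refine continuousOn_prod_of_continuousOn_lipschitzOnWith' _ C.toNNReal ?_ ?_
  · intro x hx
    refine LipschitzOnWith.of_dist_le_mul fun a ha b hb => ?_
    have h0 : (0 : ℝ) ∈ Set.Icc 0 T := ⟨le_rfl, ha.1.trans ha.2⟩
    rw [Real.dist_eq, Real.dist_eq, integral_interval_sub_left
      (h.intervalIntegrable hx h0 ha) (h.intervalIntegrable hx h0 hb)]
    exact (h.abs_integral_le hx hb ha).trans
      (mul_le_mul_of_nonneg_right (Real.le_coe_toNNReal C) (abs_nonneg _))
  · intro t ht x hx
    refine continuousWithinAt_of_dominated_interval (bound := fun _ => C) ?_ ?_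
      intervalIntegrable_const ?_
    · filter_upwards [self_mem_nhdsWithin] with ξ hξ
      exact (h.intervalIntegrable hξ ⟨le_rfl, ht.1.trans ht.2⟩ ht).def'.1
    · filter_upwards [self_mem_nhdsWithin] with ξ hξ
      refine Eventually.of_forall fun s hs => ?_
      rw [Set.uIoc_of_le ht.1] at hs
      exact h.bdd' hξ s ⟨hs.1, hs.2.trans ht.2⟩
    · refine Eventually.of_forall fun s hs => ?_
      rw [Set.uIoc_of_le ht.1] at hs
      exact h.continuousOn_space ⟨hs.1, hs.2.trans ht.2⟩ x hx

theorem continuousOn_space_Ioi (h : HeatSolution T C q p r) {t : ℝ} (ht : t ∈ Set.Ioc 0 T) :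
    ContinuousOn (fun x => q x t) (Set.Ioi 0) :=
  (h.continuousOn_space ht).mono Set.Ioi_subset_Ici_self

/-- The double space primitive of `q · ε` vanishes as `ε → 0`. -/
theorem tendsto_double_primitive (h : HeatSolution T C q p r) {x t : ℝ} (hx : 0 < x)
    (ht : t ∈ Set.Ioc 0 T) :
    Tendsto (fun ε => ∫ w in (1 : ℝ)..x, ∫ z in (1 : ℝ)..w, (q z t - q z ε)) (𝓝[>] 0)
      (𝓝 (∫ w in (1 : ℝ)..x, ∫ z in (1 : ℝ)..w, q z t)) := by
  have hT : 0 < T := ht.1.trans_le ht.2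
  have hmem : ∀ᶠ ε in 𝓝[>] (0 : ℝ), ε ∈ Set.Ioc 0 T := Ioc_mem_nhdsGT hT
  have hpos : ∀ {w z : ℝ}, w ∈ Set.uIoc 1 x → z ∈ Set.uIoc 1 w → 0 < z := fun hw hz =>
    uIcc_one_subset_Ioi (uIcc_one_subset_Ioi hx (Set.uIoc_subset_uIcc hw))
      (Set.uIoc_subset_uIcc hz)
  have hbd : ∀ ε ∈ Set.Ioc 0 T, ∀ z > 0, ‖q z t - q z ε‖ ≤ 2 * C := fun ε hε z hz => by
    have h1 := h.bdd' hz.le t ht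
    have h2 := h.bdd' hz.le ε hε
    calc ‖q z t - q z ε‖ ≤ |q z t| + |q z ε| := abs_sub _ _
      _ ≤ 2 * C := by linarith
  refine tendsto_integral_filter_of_dominated_convergence (fun w => 2 * C * |w - 1|) ?_ ?_ ?_ ?_
  · filter_upwards [hmem] with ε hε
    have := ((continuousOn_primitive_Ioi ((h.continuousOn_space_Ioi ht).sub
      (h.continuousOn_space_Ioi hε))).mono (uIcc_one_subset_Ioi hx)).intervalIntegrable
        (μ := volume)
    exact this.def'.1
  · filter_upwards [hmem] with ε hε
    exact Eventually.of_forall fun w hw =>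
      norm_integral_le_of_norm_le_const fun z hz => hbd ε hε z (hpos hw hz)
  · exact Continuous.intervalIntegrable (by fun_prop) _ _
  · refine Eventually.of_forall fun w hw => ?_
    have hw0 : 0 < w := uIcc_one_subset_Ioi hx (Set.uIoc_subset_uIcc hw)
    refine tendsto_integral_filter_of_dominated_convergence (fun _ => 2 * C) ?_ ?_
      intervalIntegrable_const ?_
    · filter_upwards [hmem] with ε hε
      have := (((h.continuousOn_space_Ioi ht).sub
        (h.continuousOn_space_Ioi hε)).mono (uIcc_one_subset_Ioi hw0)).intervalIntegrable
          (μ := volume)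
      exact this.def'.1
    · filter_upwards [hmem] with ε hε
      exact Eventually.of_forall fun z hz => hbd ε hε z (hpos hw hz)
    · refine Eventually.of_forall fun z hz => ?_
      have hz0 := hpos hw hz
      have h1 : Tendsto (q z) (𝓝[>] 0) (𝓝 (q z 0)) :=
        ((h.continuousOn_time hz0) 0 ⟨le_rfl, hT.le⟩).tendsto.mono_left
          (nhdsWithin_le_of_mem (mem_of_superset (Ioc_mem_nhdsGT hT) Set.Ioc_subset_Icc_self))
      rw [h.initial z hz0] at h1
      simpa using (tendsto_const_nhds (x := q z t)).sub h1

/-- The time primitive of `q` has second space derivative `q`. -/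
theorem hasSndDerivAt_integral (h : HeatSolution T C q p r) {x t : ℝ} (hx : 0 < x)
    (ht : t ∈ Set.Ioc 0 T) :
    HasSndDerivAt (fun ξ => ∫ s in (0 : ℝ)..t, q ξ s) (q x t) x := by
  have hT : 0 < T := ht.1.trans_le ht.2
  have h0 : (0 : ℝ) ∈ Set.Icc 0 T := ⟨le_rfl, hT.le⟩
  have ht' := Set.Ioc_subset_Icc_self ht
  have hq : ContinuousOn (fun z : ℝ × ℝ => q z.1 z.2) (Set.Ioi 0 ×ˢ Set.Ioc 0 T) :=
    h.continuousOn_closed.mono (Set.prod_mono Set.Ioi_subset_Ici_self subset_rfl)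
  have hε : ∀ ε ∈ Set.Ioo 0 t, ∀ x > 0, ∫ s in ε..t, q x s = (∫ s in ε..t, q 1 s)
      + (x - 1) * ((∫ s in ε..t, q 2 s) - (∫ s in ε..t, q 1 s)
        - ∫ w in (1 : ℝ)..2, ∫ z in (1 : ℝ)..w, (q z t - q z ε))
      + ∫ w in (1 : ℝ)..x, ∫ z in (1 : ℝ)..w, (q z t - q z ε) := by
    intro ε hε x hx
    have hεT : ε ∈ Set.Ioc 0 T := ⟨hε.1, hε.2.le.trans ht.2⟩
    refine eq_double_primitive (g := fun x => ∫ s in ε..t, q x s)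
      (g' := fun x => ∫ s in ε..t, p x s)
      ((h.continuousOn_space_Ioi ht).sub (h.continuousOn_space_Ioi hεT))
      (fun x hx => hasDerivAt_integral_of_continuousOn hε.1 hε.2.le ht.2 hx hq h.cont_x h.deriv_x)
      (fun x hx => ?_) hx
    refine (hasDerivAt_integral_of_continuousOn hε.1 hε.2.le ht.2 hx h.cont_x h.cont_xx
      h.deriv_xx).congr_deriv ?_
    have hsub : Set.Icc ε t ⊆ Set.Ioc 0 T := fun s hs => ⟨hε.1.trans_le hs.1, hs.2.trans ht.2⟩
    refine integral_eq_sub_of_hasDerivAt_of_le hε.2.le ((h.continuousOn_time' hx.le).mono hsub)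
      (fun s hs => (h.deriv_t x hx s (hsub (Set.Ioo_subset_Icc_self hs))).hasDerivAt ?_) ?_
    · exact mem_of_superset (Icc_mem_nhds hs.1 hs.2) hsub
    · refine ContinuousOn.intervalIntegrable ?_
      rw [Set.uIcc_of_le hε.2.le]
      exact h.cont_xx.comp (f := fun s => (x, s)) (by fun_prop) fun s hs => ⟨hx, hsub hs⟩
  have hlim : ∀ x > 0, Tendsto (fun ε => ∫ s in ε..t, q x s) (𝓝[>] 0)
      (𝓝 (∫ s in (0 : ℝ)..t, q x s)) := by
    intro x hx
    have h1 : ContinuousOn (fun τ => ∫ s in (0 : ℝ)..τ, q x s) (Set.Icc 0 T) :=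
      h.continuousOn_integral.comp (f := fun τ => (x, τ)) (by fun_prop) fun _ hτ => ⟨hx.le, hτ⟩
    have h2 : Tendsto (fun τ => ∫ s in (0 : ℝ)..τ, q x s) (𝓝[>] 0) (𝓝 0) := by
      have := (h1 0 h0).tendsto.mono_left
        (nhdsWithin_le_of_mem (mem_of_superset (Ioc_mem_nhdsGT hT) Set.Ioc_subset_Icc_self))
      simpa using this
    have h3 := (tendsto_const_nhds (x := ∫ s in (0 : ℝ)..t, q x s)).sub h2
    rw [sub_zero] at h3
    refine h3.congr' ?_
    filter_upwards [Ioc_mem_nhdsGT hT] with ε hε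
    exact integral_interval_sub_left (h.intervalIntegrable hx.le h0 ht')
      (h.intervalIntegrable hx.le h0 (Set.Ioc_subset_Icc_self hε))
  obtain ⟨c, hc⟩ : ∃ c, ∀ x > 0, ∫ s in (0 : ℝ)..t, q x s = (∫ s in (0 : ℝ)..t, q 1 s)
      + (x - 1) * c + ∫ w in (1 : ℝ)..x, ∫ z in (1 : ℝ)..w, q z t := by
    refine ⟨(∫ s in (0 : ℝ)..t, q 2 s) - (∫ s in (0 : ℝ)..t, q 1 s)
        - ∫ w in (1 : ℝ)..2, ∫ z in (1 : ℝ)..w, q z t, fun x hx => ?_⟩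
    refine tendsto_nhds_unique (hlim x hx) ?_
    have := ((hlim 1 one_pos).add ((tendsto_const_nhds (x := x - 1)).mul
      (((hlim 2 two_pos).sub (hlim 1 one_pos)).sub
        (h.tendsto_double_primitive two_pos ht)))).add (h.tendsto_double_primitive hx ht)
    refine this.congr' ?_
    filter_upwards [Ioo_mem_nhdsGT ht.1] with ε hε' using (hε ε hε' x hx).symm
  have hm := h.continuousOn_space_Ioi ht
  refine ⟨fun ξ => c + ∫ z in (1 : ℝ)..ξ, q z t, ?_,
    (hasDerivAt_primitive_of_continuousOn_Ioi hm hx).const_add c⟩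
  filter_upwards [Ioi_mem_nhds hx] with ξ hξ
  have h1 : HasDerivAt (fun x => (∫ s in (0 : ℝ)..t, q 1 s) + (x - 1) * c
      + ∫ w in (1 : ℝ)..x, ∫ z in (1 : ℝ)..w, q z t) (c + ∫ z in (1 : ℝ)..ξ, q z t) ξ := by
    have := ((((hasDerivAt_id ξ).sub_const 1).mul_const c).const_add
      (∫ s in (0 : ℝ)..t, q 1 s)).add
      (hasDerivAt_primitive_of_continuousOn_Ioi (continuousOn_primitive_Ioi hm) hξ)
    exact this.congr_deriv (by simp)
  refine h1.congr_of_eventuallyEq ?_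
  filter_upwards [Ioi_mem_nhds hξ] with x hx using hc x hx

end HeatSolution

/-- The complementary error function. -/
noncomputable def erfc (z : ℝ) : ℝ :=
  1 - 2 / √Real.pi * ∫ w in (0 : ℝ)..z, Real.exp (-w ^ 2)

theorem hasDerivAt_erfc (z : ℝ) : HasDerivAt erfc (-(2 / √Real.pi * Real.exp (-z ^ 2))) z := by
  have hc : Continuous fun w : ℝ => Real.exp (-w ^ 2) := by fun_prop
  exact ((hc.integral_hasStrictDerivAt 0 z).hasDerivAt.const_mul _).const_sub 1

theorem continuous_erfc : Continuous erfc :=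
  continuous_iff_continuousAt.2 fun z => (hasDerivAt_erfc z).continuousAt

@[simp] theorem erfc_zero : erfc 0 = 1 := by simp [erfc]

theorem tendsto_erfc_atTop : Tendsto erfc atTop (𝓝 0) := by
  have hi : IntegrableOn (fun w : ℝ => Real.exp (-w ^ 2)) (Set.Ioi 0) := by
    have := (integrable_exp_neg_mul_sq one_pos).integrableOn (s := Set.Ioi 0)
    simpa using this
  have h1 := intervalIntegral_tendsto_integral_Ioi 0 hi tendsto_id
  have h2 : ∫ w in Set.Ioi (0 : ℝ), Real.exp (-w ^ 2) = √Real.pi / 2 := by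
    simpa using integral_gaussian_Ioi 1
  rw [h2] at h1
  have h3 := (h1.const_mul (2 / √Real.pi)).const_sub 1
  have h4 : 1 - 2 / √Real.pi * (√Real.pi / 2) = 0 := by
    have : √Real.pi ≠ 0 := (Real.sqrt_pos.2 Real.pi_pos).ne'
    field_simp
    ring
  rw [h4] at h3
  exact h3

theorem antitone_erfc : Antitone erfc := by
  refine antitone_of_deriv_nonpos (fun z => (hasDerivAt_erfc z).differentiableAt) fun z => ?_
  rw [(hasDerivAt_erfc z).deriv, neg_nonpos]
  positivity

theorem abs_erfc_le_one {z : ℝ} (hz : 0 ≤ z) : |erfc z| ≤ 1 := by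
  rw [abs_of_nonneg (antitone_erfc.le_of_tendsto tendsto_erfc_atTop z)]
  exact (antitone_erfc hz).trans_eq erfc_zero

/-- Twice the heat kernel on the line; it vanishes for `τ ≤ 0`. -/
noncomputable def heatKernel (x τ : ℝ) : ℝ := (√(Real.pi * τ))⁻¹ * Real.exp (-(x ^ 2 / (4 * τ)))

/-- Minus the space derivative of `heatKernel`. -/
noncomputable def heatFlux (x τ : ℝ) : ℝ := x / (2 * τ) * heatKernel x τ

/-- The solution of the heat equation on the half line with unit boundary data and zero initial
data, extended by zero to `τ ≤ 0`. -/
noncomputable def heatStep (x τ : ℝ) : ℝ := if 0 < τ then erfc (x / (2 * √τ)) else 0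

theorem heatKernel_of_nonpos (x : ℝ) {τ : ℝ} (hτ : τ ≤ 0) : heatKernel x τ = 0 := by
  rw [heatKernel, Real.sqrt_eq_zero'.2 (mul_nonpos_of_nonneg_of_nonpos Real.pi_pos.le hτ)]
  simp

theorem heatFlux_of_nonpos (x : ℝ) {τ : ℝ} (hτ : τ ≤ 0) : heatFlux x τ = 0 := by
  rw [heatFlux, heatKernel_of_nonpos x hτ, mul_zero]

theorem heatStep_of_nonpos (x : ℝ) {τ : ℝ} (hτ : τ ≤ 0) : heatStep x τ = 0 :=
  if_neg hτ.not_gt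

theorem abs_heatStep_le_one {x : ℝ} (hx : 0 ≤ x) (τ : ℝ) : |heatStep x τ| ≤ 1 := by
  unfold heatStep
  split_ifs
  · exact abs_erfc_le_one (by positivity)
  · simp

theorem abs_heatKernel_le (x τ : ℝ) : |heatKernel x τ| ≤ (√τ)⁻¹ := by
  rcases le_or_gt τ 0 with h | h
  · rw [heatKernel_of_nonpos x h, abs_zero]
    positivity
  rw [heatKernel, abs_mul, abs_of_nonneg (by positivity), abs_of_pos (Real.exp_pos _)]
  have h1 : Real.exp (-(x ^ 2 / (4 * τ))) ≤ 1 := Real.exp_le_one_iff.2 (by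
    have : 0 ≤ x ^ 2 / (4 * τ) := by positivity
    linarith)
  have h2 : (√(Real.pi * τ))⁻¹ ≤ (√τ)⁻¹ := by
    apply inv_anti₀ (Real.sqrt_pos.2 h)
    exact Real.sqrt_le_sqrt (by nlinarith [Real.pi_gt_three])
  calc _ ≤ (√τ)⁻¹ * 1 := mul_le_mul h2 h1 (Real.exp_pos _).le (by positivity)
    _ = _ := mul_one _

theorem exp_neg_le_two_div_sq {y : ℝ} (hy : 0 < y) : Real.exp (-y) ≤ 2 / y ^ 2 := by
  rw [Real.exp_neg, inv_le_comm₀ (Real.exp_pos y) (by positivity), inv_div]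
  linarith [Real.quadratic_le_exp_of_nonneg hy.le]

theorem abs_heatFlux_le {x : ℝ} (hx : 0 < x) (τ : ℝ) : |heatFlux x τ| ≤ 16 * √τ / x ^ 3 := by
  rcases le_or_gt τ 0 with h | h
  · rw [heatFlux_of_nonpos x h, abs_zero]
    positivity
  have h1 := exp_neg_le_two_div_sq (y := x ^ 2 / (4 * τ)) (by positivity)
  have h2 : (√(Real.pi * τ))⁻¹ ≤ (√τ)⁻¹ := by
    apply inv_anti₀ (Real.sqrt_pos.2 h)
    exact Real.sqrt_le_sqrt (by nlinarith [Real.pi_gt_three])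
  rw [heatFlux, heatKernel, abs_of_nonneg (by positivity)]
  calc _ ≤ x / (2 * τ) * ((√τ)⁻¹ * (2 / (x ^ 2 / (4 * τ)) ^ 2)) := by
        gcongr
    _ = 16 * √τ / x ^ 3 := by
        obtain ⟨ρ, hρ, rfl⟩ : ∃ ρ, 0 < ρ ∧ τ = ρ ^ 2 :=
          ⟨√τ, Real.sqrt_pos.2 h, (Real.sq_sqrt h.le).symm⟩
        rw [Real.sqrt_sq hρ.le]
        field_simp
        norm_num

theorem hasDerivAt_heatStep_space (x τ : ℝ) :
    HasDerivAt (fun ξ => heatStep ξ τ) (-heatKernel x τ) x := by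
  rcases le_or_gt τ 0 with h | h
  · simp only [heatStep_of_nonpos _ h, heatKernel_of_nonpos _ h, neg_zero]
    exact hasDerivAt_const x 0
  simp only [heatStep, if_pos h, heatKernel]
  have := (hasDerivAt_erfc (x / (2 * √τ))).comp x ((hasDerivAt_id x).div_const (2 * √τ))
  refine this.congr_deriv ?_
  rw [Real.sqrt_mul Real.pi_pos.le, div_pow, mul_pow, Real.sq_sqrt h.le]
  have h1 : √τ ≠ 0 := (Real.sqrt_pos.2 h).ne'
  have h2 : √Real.pi ≠ 0 := (Real.sqrt_pos.2 Real.pi_pos).ne'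
  norm_num
  field_simp

theorem hasDerivAt_heatKernel_space (x τ : ℝ) :
    HasDerivAt (fun ξ => heatKernel ξ τ) (-heatFlux x τ) x := by
  have := ((((hasDerivAt_id x).pow 2).div_const (4 * τ)).neg.exp).const_mul (√(Real.pi * τ))⁻¹
  refine this.congr_deriv ?_
  rcases eq_or_ne τ 0 with rfl | h
  · simp [heatFlux]
  · simp only [heatFlux, heatKernel, id]
    field_simp
    norm_num
    ring

theorem continuous_heatFlux_time {x : ℝ} (hx : 0 < x) : Continuous (heatFlux x) := by
  refine continuous_iff_continuousAt.2 fun τ => ?_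
  rcases lt_trichotomy τ 0 with h | rfl | h
  · refine (continuousAt_const (y := (0 : ℝ))).congr ?_
    filter_upwards [Iio_mem_nhds h] with σ hσ using (heatFlux_of_nonpos x (le_of_lt hσ)).symm
  · rw [ContinuousAt, heatFlux_of_nonpos x le_rfl]
    have h1 : Tendsto (fun τ => 16 * √τ / x ^ 3) (𝓝 0) (𝓝 0) := by
      have : Continuous fun τ => 16 * √τ / x ^ 3 := by fun_prop
      simpa using this.tendsto 0
    exact squeeze_zero_norm (fun τ => abs_heatFlux_le hx τ) h1
  · unfold heatFlux heatKernel
    have h2 : √(Real.pi * τ) ≠ 0 := (Real.sqrt_pos.2 (mul_pos Real.pi_pos h)).ne'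
    have h3 : 2 * τ ≠ 0 := by positivity
    have h4 : 4 * τ ≠ 0 := by positivity
    fun_prop (disch := assumption)

theorem hasDerivAt_heatStep_time {x : ℝ} (hx : 0 < x) (τ : ℝ) :
    HasDerivAt (heatStep x) (heatFlux x τ) τ := by
  have hpos : ∀ τ > 0, HasDerivAt (heatStep x) (heatFlux x τ) τ := by
    intro τ h
    have h1 : √τ ≠ 0 := (Real.sqrt_pos.2 h).ne'
    have h2 : √Real.pi ≠ 0 := (Real.sqrt_pos.2 Real.pi_pos).ne'
    have h3 : HasDerivAt (fun σ => x / (2 * √σ)) (-(x / (4 * τ * √τ))) τ := by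
      have := (hasDerivAt_const τ x).div ((Real.hasDerivAt_sqrt h.ne').const_mul 2)
        (by positivity)
      refine this.congr_deriv ?_
      rw [mul_pow, Real.sq_sqrt h.le]
      field_simp
      ring
    have h4 := (hasDerivAt_erfc (x / (2 * √τ))).comp τ h3
    refine (h4.congr_deriv ?_).congr_of_eventuallyEq ?_
    · rw [heatFlux, heatKernel, Real.sqrt_mul Real.pi_pos.le, div_pow, mul_pow, Real.sq_sqrt h.le]
      norm_num
      field_simp
      norm_num
    · filter_upwards [Ioi_mem_nhds h] with σ hσ
      simp [heatStep, if_pos (show 0 < σ from hσ)]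
  have hneg : ∀ τ < 0, HasDerivAt (heatStep x) (heatFlux x τ) τ := by
    intro τ h
    rw [heatFlux_of_nonpos x h.le]
    refine (hasDerivAt_const τ (0 : ℝ)).congr_of_eventuallyEq ?_
    filter_upwards [Iio_mem_nhds h] with σ hσ using heatStep_of_nonpos x (le_of_lt hσ)
  rcases lt_trichotomy τ 0 with h | rfl | h
  · exact hneg τ h
  · refine hasDerivAt_of_hasDerivAt_of_ne (fun τ hτ => ?_) ?_
      (continuous_heatFlux_time hx).continuousAt
    · exact (lt_or_gt_of_ne hτ).elim (hneg τ) (hpos τ)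
    · rw [continuousAt_iff_continuous_left'_right']
      constructor
      · refine (continuousWithinAt_const (b := (0 : ℝ))).congr (fun σ hσ => ?_) ?_
        · exact heatStep_of_nonpos x (le_of_lt hσ)
        · exact heatStep_of_nonpos x le_rfl
      · rw [ContinuousWithinAt, heatStep_of_nonpos x le_rfl]
        have h1 : Tendsto (fun σ : ℝ => 2 * √σ) (𝓝[>] 0) (𝓝[>] 0) := by
          refine tendsto_nhdsWithin_iff.2 ⟨?_, ?_⟩
          · have : Continuous fun σ : ℝ => 2 * √σ := by fun_prop
            have := this.tendsto 0
            simp only [Real.sqrt_zero, mul_zero] at this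
            exact this.mono_left nhdsWithin_le_nhds
          · filter_upwards [self_mem_nhdsWithin] with σ hσ
            have := Real.sqrt_pos.2 (show 0 < σ from hσ)
            exact Set.mem_Ioi.2 (by positivity)
        have h2 := tendsto_erfc_atTop.comp (h1.inv_tendsto_nhdsGT_zero.const_mul_atTop hx)
        refine h2.congr' ?_
        filter_upwards [self_mem_nhdsWithin] with σ hσ
        simp [heatStep, if_pos (show 0 < σ from hσ), div_eq_mul_inv]
  · exact hpos τ h

theorem continuousAt_heatStep (x : ℝ) {τ : ℝ} (hτ : τ ≠ 0) :
    ContinuousAt (fun z : ℝ × ℝ => heatStep z.1 z.2) (x, τ) := by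
  rcases lt_or_gt_of_ne hτ with h | h
  · refine (continuousAt_const (y := (0 : ℝ))).congr ?_
    filter_upwards [continuousAt_snd.eventually (Iio_mem_nhds h)] with z hz
    exact (heatStep_of_nonpos _ (le_of_lt hz)).symm
  · have h1 : (2 : ℝ) * √τ ≠ 0 := by positivity
    have h2 : ContinuousAt (fun z : ℝ × ℝ => erfc (z.1 / (2 * √z.2))) (x, τ) := by
      refine continuous_erfc.continuousAt.comp ?_
      exact continuousAt_fst.div (by fun_prop) h1
    refine h2.congr ?_
    filter_upwards [continuousAt_snd.eventually (Ioi_mem_nhds h)] with z hz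
    simp [heatStep, if_pos (show 0 < z.2 from hz)]

theorem measurable_heatStep (x : ℝ) : Measurable (heatStep x) := by
  unfold heatStep
  exact Measurable.ite measurableSet_Ioi (continuous_erfc.measurable.comp (by fun_prop))
    measurable_const

theorem measurable_heatKernel (x : ℝ) : Measurable (heatKernel x) := by
  unfold heatKernel; fun_prop

theorem measurable_heatFlux (x : ℝ) : Measurable (heatFlux x) := by
  unfold heatFlux heatKernel; fun_prop

theorem intervalIntegrable_inv_sqrt (a b : ℝ) :
    IntervalIntegrable (fun s => (√s)⁻¹) volume a b := by
  have h0 : ∀ b : ℝ, 0 ≤ b → IntervalIntegrable (fun s => (√s)⁻¹) volume 0 b := by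
    intro b hb
    refine (intervalIntegrable_rpow' (a := 0) (b := b) (r := -(1 / 2)) (by norm_num)).congr ?_
    intro s hs
    rw [Set.uIoc_of_le hb] at hs
    simp only
    rw [Real.rpow_neg hs.1.le, Real.sqrt_eq_rpow]
  have h1 : ∀ b : ℝ, IntervalIntegrable (fun s => (√s)⁻¹) volume 0 b := by
    intro b
    rcases le_total 0 b with hb | hb
    · exact h0 b hb
    · refine (intervalIntegrable_const (c := (0 : ℝ))).congr ?_
      intro s hs
      rw [Set.uIoc_of_ge hb] at hs
      simp [Real.sqrt_eq_zero'.2 hs.2]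
  exact (h1 a).symm.trans (h1 b)

theorem intervalIntegrable_inv_sqrt_sub (t a b : ℝ) :
    IntervalIntegrable (fun s => (√(t - s))⁻¹) volume a b := by
  have := (intervalIntegrable_inv_sqrt (t - a) (t - b)).comp_sub_left t
  simpa using this

section Potential

variable {f : ℝ → ℝ} {T C : ℝ}

theorem aestronglyMeasurable_kernel_mul {κ : ℝ → ℝ} (hκ : Measurable κ)
    (hf : ContinuousOn f (Set.Ioc 0 T)) {t b : ℝ} (hb : b ∈ Set.Icc 0 T) :
    AEStronglyMeasurable (fun s => κ (t - s) * f s) (volume.restrict (Set.uIoc 0 b)) := by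
  rw [Set.uIoc_of_le hb.1]
  refine (hκ.comp (by fun_prop : Measurable fun s : ℝ => t - s)).aestronglyMeasurable.mul ?_
  exact (hf.mono (Set.Ioc_subset_Ioc_right hb.2)).aestronglyMeasurable measurableSet_Ioc

theorem intervalIntegrable_heatStep_mul (hf : ContinuousOn f (Set.Ioc 0 T))
    (hC : ∀ t ∈ Set.Ioc 0 T, |f t| ≤ C) {x : ℝ} (hx : 0 ≤ x) (t : ℝ) {b : ℝ}
    (hb : b ∈ Set.Icc 0 T) :
    IntervalIntegrable (fun s => heatStep x (t - s) * f s) volume 0 b := by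
  refine (intervalIntegrable_const (c := C)).mono_fun'
    (aestronglyMeasurable_kernel_mul (measurable_heatStep x) hf hb) ?_
  refine (ae_restrict_iff' measurableSet_uIoc).2 (Eventually.of_forall fun s hs => ?_)
  rw [Set.uIoc_of_le hb.1] at hs
  have h1 := hC s ⟨hs.1, hs.2.trans hb.2⟩
  simp only [Real.norm_eq_abs, abs_mul]
  calc _ ≤ 1 * |f s| := mul_le_mul_of_nonneg_right (abs_heatStep_le_one hx _) (abs_nonneg _)
    _ ≤ C := by linarith

theorem intervalIntegrable_heatKernel_mul (hf : ContinuousOn f (Set.Ioc 0 T))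
    (hC : ∀ t ∈ Set.Ioc 0 T, |f t| ≤ C) (x t : ℝ) {b : ℝ} (hb : b ∈ Set.Icc 0 T) :
    IntervalIntegrable (fun s => heatKernel x (t - s) * f s) volume 0 b := by
  refine ((intervalIntegrable_inv_sqrt_sub t 0 b).mul_const C).mono_fun'
    (aestronglyMeasurable_kernel_mul (measurable_heatKernel x) hf hb) ?_
  refine (ae_restrict_iff' measurableSet_uIoc).2 (Eventually.of_forall fun s hs => ?_)
  rw [Set.uIoc_of_le hb.1] at hs
  simp only [Real.norm_eq_abs, abs_mul]
  exact mul_le_mul (abs_heatKernel_le _ _) (hC s ⟨hs.1, hs.2.trans hb.2⟩) (abs_nonneg _)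
    (by positivity)

theorem integral_kernel_mul_extend {κ : ℝ → ℝ} (hκ : ∀ τ ≤ 0, κ τ = 0) {t b : ℝ} (htb : t ≤ b)
    (hi : IntervalIntegrable (fun s => κ (t - s) * f s) volume 0 t) :
    ∫ s in (0 : ℝ)..t, κ (t - s) * f s = ∫ s in (0 : ℝ)..b, κ (t - s) * f s := by
  have h0 : ∀ s ∈ Set.uIoc t b, (0 : ℝ) = κ (t - s) * f s := fun s hs => by
    rw [Set.uIoc_of_le htb] at hs
    rw [hκ _ (by linarith [hs.1]), zero_mul]
  have h1 : IntervalIntegrable (fun s => κ (t - s) * f s) volume t b :=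
    (intervalIntegrable_const (c := (0 : ℝ))).congr h0
  have h2 : ∫ s in t..b, κ (t - s) * f s = 0 := by
    rw [← integral_congr_ae (Eventually.of_forall h0)]
    simp
  rw [← integral_add_adjacent_intervals hi h1, h2, add_zero]

theorem hasDerivAt_potential_space (hf : ContinuousOn f (Set.Ioc 0 T))
    (hC : ∀ t ∈ Set.Ioc 0 T, |f t| ≤ C) {x t : ℝ} (hx : 0 ≤ x) (ht : t ∈ Set.Icc 0 T) :
    HasDerivAt (fun ξ => ∫ s in (0 : ℝ)..t, heatStep ξ (t - s) * f s)
      (∫ s in (0 : ℝ)..t, -heatKernel x (t - s) * f s) x := by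
  refine (intervalIntegral.hasDerivAt_integral_of_dominated_loc_of_deriv_le (s := Set.univ)
    (F' := fun x s => -heatKernel x (t - s) * f s)
    (bound := fun s => (√(t - s))⁻¹ * C) univ_mem
    (Eventually.of_forall fun ξ => aestronglyMeasurable_kernel_mul (measurable_heatStep ξ) hf ht)
    (intervalIntegrable_heatStep_mul hf hC hx t ht)
    (aestronglyMeasurable_kernel_mul (measurable_heatKernel x).neg hf ht) ?_
    ((intervalIntegrable_inv_sqrt_sub t 0 t).mul_const C) ?_).2
  · refine Eventually.of_forall fun s hs ξ _ => ?_
    rw [Set.uIoc_of_le ht.1] at hs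
    rw [Real.norm_eq_abs, abs_mul, abs_neg]
    exact mul_le_mul (abs_heatKernel_le _ _) (hC s ⟨hs.1, hs.2.trans ht.2⟩) (abs_nonneg _)
      (by positivity)
  · exact Eventually.of_forall fun s _ ξ _ => (hasDerivAt_heatStep_space ξ (t - s)).mul_const _

theorem hasDerivAt_potential_space_space (hf : ContinuousOn f (Set.Ioc 0 T))
    (hC : ∀ t ∈ Set.Ioc 0 T, |f t| ≤ C) {x t : ℝ} (hx : 0 < x) (ht : t ∈ Set.Icc 0 T) :
    HasDerivAt (fun ξ => ∫ s in (0 : ℝ)..t, -heatKernel ξ (t - s) * f s)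
      (∫ s in (0 : ℝ)..t, heatFlux x (t - s) * f s) x := by
  have hi : IntervalIntegrable (fun s => -heatKernel x (t - s) * f s) volume 0 t := by
    simpa only [neg_mul, Pi.neg_def] using (intervalIntegrable_heatKernel_mul hf hC x t ht).neg
  refine (intervalIntegral.hasDerivAt_integral_of_dominated_loc_of_deriv_le
    (s := Set.Ioi (x / 2)) (F' := fun x s => heatFlux x (t - s) * f s)
    (bound := fun s => 16 * √(t - s) / (x / 2) ^ 3 * C) (Ioi_mem_nhds (by linarith))
    (Eventually.of_forall fun ξ =>
      aestronglyMeasurable_kernel_mul (measurable_heatKernel ξ).neg hf ht) hi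
    (aestronglyMeasurable_kernel_mul (measurable_heatFlux x) hf ht) ?_
    (Continuous.intervalIntegrable (by fun_prop) _ _) ?_).2
  · refine Eventually.of_forall fun s hs ξ hξ => ?_
    rw [Set.uIoc_of_le ht.1] at hs
    have hξ' : x / 2 < ξ := hξ
    have hx2 : 0 < x / 2 := by positivity
    rw [Real.norm_eq_abs, abs_mul]
    refine mul_le_mul ((abs_heatFlux_le (hx2.trans hξ') _).trans ?_)
      (hC s ⟨hs.1, hs.2.trans ht.2⟩) (abs_nonneg _) (by positivity)
    gcongr
  · refine Eventually.of_forall fun s _ ξ _ => ?_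
    refine ((hasDerivAt_heatKernel_space ξ (t - s)).neg.mul_const (f s)).congr_deriv ?_
    rw [neg_neg]

theorem hasDerivWithinAt_potential_time (hf : ContinuousOn f (Set.Ioc 0 T))
    (hC : ∀ t ∈ Set.Ioc 0 T, |f t| ≤ C) {x t : ℝ} (hx : 0 < x) (ht : t ∈ Set.Ioc 0 T) :
    HasDerivWithinAt (fun τ => ∫ s in (0 : ℝ)..τ, heatStep x (τ - s) * f s)
      (∫ s in (0 : ℝ)..t, heatFlux x (t - s) * f s) (Set.Icc 0 t) t := by
  have hT : T ∈ Set.Icc 0 T := ⟨ht.1.le.trans ht.2, le_rfl⟩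
  have hC0 : 0 ≤ C := (abs_nonneg _).trans (hC t ht)
  have h1 := intervalIntegral.hasDerivAt_integral_of_dominated_loc_of_deriv_le (μ := volume)
    (x₀ := t) (a := 0) (b := T)
    (s := Set.Iio (t + 1)) (F := fun τ s => heatStep x (τ - s) * f s)
    (F' := fun τ s => heatFlux x (τ - s) * f s)
    (bound := fun _ => 16 * √(t + 1) / x ^ 3 * C) (Iio_mem_nhds (by linarith))
    (Eventually.of_forall fun τ => aestronglyMeasurable_kernel_mul (measurable_heatStep x) hf hT)
    (intervalIntegrable_heatStep_mul hf hC hx.le t hT)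
    (aestronglyMeasurable_kernel_mul (measurable_heatFlux x) hf hT) ?_
    intervalIntegrable_const ?_
  · have h2 : ∀ τ ∈ Set.Icc 0 t, ∫ s in (0 : ℝ)..τ, heatStep x (τ - s) * f s
        = ∫ s in (0 : ℝ)..T, heatStep x (τ - s) * f s := fun τ hτ =>
      integral_kernel_mul_extend (fun σ hσ => heatStep_of_nonpos x hσ) (hτ.2.trans ht.2)
        (intervalIntegrable_heatStep_mul hf hC hx.le τ ⟨hτ.1, hτ.2.trans ht.2⟩)
    rw [integral_kernel_mul_extend (b := T) (κ := heatFlux x)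
      (fun σ hσ => heatFlux_of_nonpos x hσ) ht.2]
    · exact h1.2.hasDerivWithinAt.congr h2 (h2 t ⟨ht.1.le, le_rfl⟩)
    · refine h1.1.mono_set ?_
      rw [Set.uIcc_of_le ht.1.le, Set.uIcc_of_le hT.1]
      exact Set.Icc_subset_Icc_right ht.2
  · refine Eventually.of_forall fun s hs τ hτ => ?_
    rw [Set.uIoc_of_le hT.1] at hs
    have hτ' : τ < t + 1 := hτ
    rw [Real.norm_eq_abs, abs_mul]
    refine mul_le_mul ((abs_heatFlux_le hx _).trans ?_) (hC s hs) (abs_nonneg _) (by positivity)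
    gcongr
    linarith [hs.1]
  · refine Eventually.of_forall fun s _ τ _ => ?_
    have h3 := (hasDerivAt_heatStep_time hx (τ - s)).comp τ ((hasDerivAt_id τ).sub_const s)
    rw [mul_one] at h3
    exact h3.mul_const (f s)

theorem continuousOn_potential (hf : ContinuousOn f (Set.Ioc 0 T))
    (hC : ∀ t ∈ Set.Ioc 0 T, |f t| ≤ C) :
    ContinuousOn (fun z : ℝ × ℝ => ∫ s in (0 : ℝ)..z.2, heatStep z.1 (z.2 - s) * f s)
      (Set.Ici 0 ×ˢ Set.Icc 0 T) := by
  have h1 : ContinuousOn (fun z : ℝ × ℝ => ∫ s in (0 : ℝ)..T, heatStep z.1 (z.2 - s) * f s)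
      (Set.Ici 0 ×ˢ Set.Icc 0 T) := by
    rintro ⟨x, t⟩ ⟨hx, ht⟩
    have hT : T ∈ Set.Icc 0 T := ⟨ht.1.trans ht.2, le_rfl⟩
    refine continuousWithinAt_of_dominated_interval (bound := fun _ => C) ?_ ?_
      intervalIntegrable_const ?_
    · exact Eventually.of_forall fun z =>
        aestronglyMeasurable_kernel_mul (measurable_heatStep _) hf hT
    · filter_upwards [self_mem_nhdsWithin] with z hz
      refine Eventually.of_forall fun s hs => ?_
      rw [Set.uIoc_of_le hT.1] at hs
      rw [Real.norm_eq_abs, abs_mul]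
      calc _ ≤ 1 * |f s| :=
            mul_le_mul_of_nonneg_right (abs_heatStep_le_one hz.1 _) (abs_nonneg _)
        _ ≤ C := by linarith [hC s hs]
    · filter_upwards [Measure.ae_ne volume t] with s hs _
      have h2 : ContinuousAt (fun z : ℝ × ℝ => heatStep z.1 (z.2 - s)) (x, t) :=
        ContinuousAt.comp (f := fun z : ℝ × ℝ => (z.1, z.2 - s)) (x := (x, t))
          (g := fun z : ℝ × ℝ => heatStep z.1 z.2) (continuousAt_heatStep x (sub_ne_zero.2 (Ne.symm hs))) (by fun_prop)
      exact (h2.mul continuousAt_const).continuousWithinAt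
  refine h1.congr fun z hz => ?_
  exact integral_kernel_mul_extend (fun σ hσ => heatStep_of_nonpos _ hσ) hz.2.2
    (intervalIntegrable_heatStep_mul hf hC hz.1 z.2 hz.2)

theorem integral_heatStep_zero (t : ℝ) (ht : 0 ≤ t) :
    ∫ s in (0 : ℝ)..t, heatStep 0 (t - s) * f s = ∫ s in (0 : ℝ)..t, f s := by
  refine integral_congr_ae ?_
  filter_upwards [Measure.ae_ne volume t] with s hs hs'
  rw [Set.uIoc_of_le ht] at hs'
  have : 0 < t - s := sub_pos.2 (lt_of_le_of_ne hs'.2 hs)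
  rw [heatStep, if_pos this, zero_div, erfc_zero, one_mul]

theorem abs_potential_le (hC : ∀ t ∈ Set.Ioc 0 T, |f t| ≤ C) {x t : ℝ} (hx : 0 ≤ x)
    (ht : t ∈ Set.Icc 0 T) :
    |∫ s in (0 : ℝ)..t, heatStep x (t - s) * f s| ≤ C * |t - 0| := by
  rw [← Real.norm_eq_abs]
  refine norm_integral_le_of_norm_le_const fun s hs => ?_
  rw [Set.uIoc_of_le ht.1] at hs
  have := hC s ⟨hs.1, hs.2.trans ht.2⟩
  rw [Real.norm_eq_abs, abs_mul]
  calc _ ≤ 1 * |f s| := mul_le_mul_of_nonneg_right (abs_heatStep_le_one hx _) (abs_nonneg _)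
    _ ≤ C := by linarith

end Potential

namespace HeatSolution

variable {T C : ℝ} {q p r : ℝ → ℝ → ℝ}

/-- The time primitive of `q` is the potential generated by its boundary values. -/
theorem integral_eq_potential (h : HeatSolution T C q p r) {x t : ℝ} (hx : 0 ≤ x)
    (ht : t ∈ Set.Icc 0 T) :
    ∫ s in (0 : ℝ)..t, q x s = ∫ s in (0 : ℝ)..t, heatStep x (t - s) * q 0 s := by
  have hf := h.continuousOn_time' le_rfl
  have hC := h.bdd' le_rfl
  have hC0 : 0 ≤ C := (abs_nonneg _).trans (h.bdd x hx t ht)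
  rw [← sub_eq_zero]
  refine heat_half_line_unique (T := T) (M := C * T + C * T)
    (z := fun x t => (∫ s in (0 : ℝ)..t, q x s) - ∫ s in (0 : ℝ)..t, heatStep x (t - s) * q 0 s)
    (h.continuousOn_integral.sub (continuousOn_potential hf hC)) ?_ ?_ ?_ ?_ x hx t ht
  · intro x hx t ht
    refine ⟨q x t - ∫ s in (0 : ℝ)..t, heatFlux x (t - s) * q 0 s,
      (h.hasDerivWithinAt_integral hx ht).sub (hasDerivWithinAt_potential_time hf hC hx ht),
      (h.hasSndDerivAt_integral hx ht).sub
        ⟨fun ξ => ∫ s in (0 : ℝ)..t, -heatKernel ξ (t - s) * q 0 s, ?_,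
          hasDerivAt_potential_space_space hf hC hx (Set.Ioc_subset_Icc_self ht)⟩⟩
    filter_upwards [Ioi_mem_nhds hx] with ξ hξ
    exact hasDerivAt_potential_space hf hC (le_of_lt hξ) (Set.Ioc_subset_Icc_self ht)
  · intro x hx t ht
    have h1 := h.abs_integral_le hx ⟨le_rfl, ht.1.trans ht.2⟩ ht
    have h2 := abs_potential_le hC hx ht
    have h3 : C * |t - 0| ≤ C * T := by
      rw [sub_zero, abs_of_nonneg ht.1]
      exact mul_le_mul_of_nonneg_left ht.2 hC0
    refine (abs_sub _ _).trans (by linarith)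
  · intro x _
    simp
  · intro t ht
    rw [integral_heatStep_zero t ht.1, sub_self]

/-- The time integral of the boundary flux is the half-order integral of the boundary values. -/
theorem integral_flux (h : HeatSolution T C q p r) {df qx : ℝ → ℝ}
    (hdf : ∀ t ∈ Set.Ioc 0 T, HasDerivWithinAt (q 0) (df t) (Set.Ioc 0 T) t)
    (hdfc : ContinuousOn df (Set.Ioc 0 T))
    (hqx : ∀ t ∈ Set.Ioc 0 T, HasDerivWithinAt (fun x => q x t) (qx t) (Set.Ici 0) 0)
    {ε t : ℝ} (hε : 0 < ε) (hεt : ε ≤ t) (ht : t ≤ T) :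
    ∫ s in ε..t, qx s = (∫ s in (0 : ℝ)..t, -heatKernel 0 (t - s) * q 0 s)
      - ∫ s in (0 : ℝ)..ε, -heatKernel 0 (ε - s) * q 0 s := by
  have hT : 0 < T := (hε.trans_le hεt).trans_le ht
  have hf := h.continuousOn_time' le_rfl
  have hC := h.bdd' le_rfl
  have h0 : (0 : ℝ) ∈ Set.Icc 0 T := ⟨le_rfl, hT.le⟩
  have htm : t ∈ Set.Icc 0 T := ⟨hε.le.trans hεt, ht⟩
  have hεm : ε ∈ Set.Icc 0 T := ⟨hε.le, hεt.trans ht⟩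
  have hslope : ∀ {g : ℝ → ℝ} {d : ℝ}, HasDerivWithinAt g d (Set.Ici 0) 0 →
      Tendsto (fun x => x⁻¹ * (g x - g 0)) (𝓝[>] 0) (𝓝 d) := by
    intro g d hg
    have := hasDerivWithinAt_iff_tendsto_slope.1 hg
    rw [Set.Ici_sdiff_left] at this
    refine this.congr fun x => ?_
    rw [slope_def_field, sub_zero, div_eq_inv_mul]
  have hQ : ∀ b ∈ Set.Icc 0 T, HasDerivWithinAt (fun x => ∫ s in (0 : ℝ)..b, q x s)
      (∫ s in (0 : ℝ)..b, -heatKernel 0 (b - s) * q 0 s) (Set.Ici 0) 0 := fun b hb =>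
    (hasDerivAt_potential_space hf hC le_rfl hb).hasDerivWithinAt.congr
      (fun x hx => h.integral_eq_potential hx hb) (h.integral_eq_potential le_rfl hb)
  have hsub : Set.Ioc ε t ⊆ Set.Ioc 0 T := Set.Ioc_subset_Ioc hε.le ht
  have h1 : Tendsto (fun x => ∫ s in ε..t, x⁻¹ * (q x s - q 0 s)) (𝓝[>] 0)
      (𝓝 (∫ s in ε..t, qx s)) := by
    obtain ⟨K, hK⟩ := h.exists_boundary_growth hε hdf hdfc
    refine tendsto_integral_filter_of_dominated_convergence (fun _ => K) ?_ ?_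
      intervalIntegrable_const ?_
    · filter_upwards [self_mem_nhdsWithin] with x hx
      exact (((h.intervalIntegrable (le_of_lt hx) hεm htm).sub
        (h.intervalIntegrable le_rfl hεm htm)).const_mul x⁻¹).def'.1
    · filter_upwards [Ioo_mem_nhdsGT one_pos] with x hx
      refine Eventually.of_forall fun s hs => ?_
      rw [Set.uIoc_of_le hεt] at hs
      have := hK s ⟨hs.1.le, hs.2.trans ht⟩ x ⟨hx.1.le, hx.2.le⟩
      rw [Real.norm_eq_abs, abs_mul, abs_of_pos (inv_pos.2 hx.1), inv_mul_le_iff₀ hx.1]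
      linarith
    · refine Eventually.of_forall fun s hs => ?_
      rw [Set.uIoc_of_le hεt] at hs
      exact hslope (hqx s (hsub hs))
  refine tendsto_nhds_unique h1 ?_
  refine (hslope ((hQ t htm).sub (hQ ε hεm))).congr' ?_
  filter_upwards [self_mem_nhdsWithin] with x hx
  have hx' : 0 ≤ x := le_of_lt hx
  have hI := fun {y : ℝ} (hy : 0 ≤ y) => integral_interval_sub_left
    (h.intervalIntegrable hy h0 htm) (h.intervalIntegrable hy h0 hεm)
  rw [intervalIntegral.integral_const_mul, intervalIntegral.integral_sub
    (h.intervalIntegrable hx' hεm htm) (h.intervalIntegrable le_rfl hεm htm),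
    ← hI hx', ← hI le_rfl]
  rfl

end HeatSolution

/-- The Abel transform of `φ`. -/
noncomputable def abel (φ : ℝ → ℝ) (t : ℝ) : ℝ := ∫ s in (0 : ℝ)..t, (√(t - s))⁻¹ * φ s

theorem beta_half_half {r t : ℝ} (hrt : r < t) :
    IntervalIntegrable (fun s => (√(t - s))⁻¹ * (√(s - r))⁻¹) volume r t ∧
      ∫ s in r..t, (√(t - s))⁻¹ * (√(s - r))⁻¹ = Real.pi := by
  have hd : 0 < t - r := sub_pos.2 hrt
  have hcont : ContinuousOn (fun s => Real.arcsin ((2 * s - r - t) / (t - r))) (Set.Icc r t) :=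
    (Real.continuous_arcsin.comp (by fun_prop)).continuousOn
  have hderiv : ∀ s ∈ Set.Ioo r t, HasDerivAt
      (fun s => Real.arcsin ((2 * s - r - t) / (t - r))) ((√(t - s))⁻¹ * (√(s - r))⁻¹) s := by
    intro s hs
    have h1 : 0 < t - s := sub_pos.2 hs.2
    have h2 : 0 < s - r := sub_pos.2 hs.1
    have hl : (2 * s - r - t) / (t - r) ≠ -1 := by
      rw [ne_eq, div_eq_iff hd.ne']; intro h; linarith
    have hu : (2 * s - r - t) / (t - r) ≠ 1 := by
      rw [ne_eq, div_eq_iff hd.ne']; intro h; linarith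
    have h3 : HasDerivAt (fun s => (2 * s - r - t) / (t - r)) (2 / (t - r)) s := by
      have := ((((hasDerivAt_id s).const_mul 2).sub_const r).sub_const t).div_const (t - r)
      exact this.congr_deriv (by simp)
    refine ((Real.hasDerivAt_arcsin hl hu).comp s h3).congr_deriv ?_
    have h4 : 1 - ((2 * s - r - t) / (t - r)) ^ 2 = (2 / (t - r)) ^ 2 * ((t - s) * (s - r)) := by
      field_simp
      ring
    rw [h4, Real.sqrt_mul (by positivity), Real.sqrt_sq (by positivity), Real.sqrt_mul h1.le]
    have := (Real.sqrt_pos.2 h1).ne'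
    have := (Real.sqrt_pos.2 h2).ne'
    field_simp
  have hint : IntervalIntegrable (fun s => (√(t - s))⁻¹ * (√(s - r))⁻¹) volume r t := by
    rw [intervalIntegrable_iff_integrableOn_Ioc_of_le hrt.le]
    exact integrableOn_deriv_of_nonneg hcont hderiv fun s _ => by positivity
  refine ⟨hint, ?_⟩
  rw [integral_eq_sub_of_hasDerivAt_of_le hrt.le hcont hderiv hint]
  have h5 : (2 * t - r - t) / (t - r) = 1 := by
    rw [div_eq_one_iff_eq hd.ne']; ring
  have h6 : (2 * r - r - t) / (t - r) = -1 := by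
    rw [div_eq_iff hd.ne']; ring
  rw [h5, h6, Real.arcsin_one, Real.arcsin_neg_one]
  ring

theorem beta_half_half_extend {r t : ℝ} (hr : 0 ≤ r) (hrt : r < t) :
    IntervalIntegrable (fun s => (√(t - s))⁻¹ * (√(s - r))⁻¹) volume 0 t ∧
      ∫ s in (0 : ℝ)..t, (√(t - s))⁻¹ * (√(s - r))⁻¹ = Real.pi := by
  obtain ⟨hi, hv⟩ := beta_half_half hrt
  have h0 : ∀ s ∈ Set.uIoc 0 r, (0 : ℝ) = (√(t - s))⁻¹ * (√(s - r))⁻¹ := fun s hs => by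
    rw [Set.uIoc_of_le hr] at hs
    rw [Real.sqrt_eq_zero'.2 (sub_nonpos.2 hs.2), inv_zero, mul_zero]
  have h1 : IntervalIntegrable (fun s => (√(t - s))⁻¹ * (√(s - r))⁻¹) volume 0 r :=
    (intervalIntegrable_const (c := (0 : ℝ))).congr h0
  refine ⟨h1.trans hi, ?_⟩
  rw [← integral_add_adjacent_intervals h1 hi, hv,
    ← integral_congr_ae (Eventually.of_forall h0)]
  simp

theorem abel_inv_sqrt {t : ℝ} (ht : 0 < t) : abel (fun s => (√s)⁻¹) t = Real.pi := by
  simpa [abel] using (beta_half_half ht).2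

theorem abel_congr {φ ψ : ℝ → ℝ} {t : ℝ} (ht : 0 ≤ t) (h : ∀ s ∈ Set.Ioc 0 t, φ s = ψ s) :
    abel φ t = abel ψ t := by
  refine integral_congr_ae (Eventually.of_forall fun s hs => ?_)
  rw [Set.uIoc_of_le ht] at hs
  rw [h s hs]

/-- The Abel transform is a square root of `π` times integration. -/
theorem abel_abel {φ : ℝ → ℝ} {t : ℝ} (ht : 0 ≤ t) (hφ : IntervalIntegrable φ volume 0 t) :
    abel (abel φ) t = Real.pi * ∫ s in (0 : ℝ)..t, φ s := by
  have hφ' : IntegrableOn φ (Set.Ioc 0 t) :=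
    (intervalIntegrable_iff_integrableOn_Ioc_of_le ht).1 hφ
  set μ := (volume : Measure ℝ).restrict (Set.Ioc 0 t) with hμ
  have hne : ∀ᵐ r ∂μ, 0 ≤ r ∧ r < t := by
    rw [hμ, ae_restrict_iff' measurableSet_Ioc]
    filter_upwards [Measure.ae_ne volume t] with r hr hr'
    exact ⟨hr'.1.le, lt_of_le_of_ne hr'.2 hr⟩
  have hmeas : AEStronglyMeasurable
      (Function.uncurry fun s r => (√(t - s))⁻¹ * (√(s - r))⁻¹ * φ r) (μ.prod μ) := by
    refine AEStronglyMeasurable.mul (Measurable.aestronglyMeasurable (by fun_prop)) ?_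
    exact hφ'.1.comp_snd
  have hint : Integrable (Function.uncurry fun s r => (√(t - s))⁻¹ * (√(s - r))⁻¹ * φ r)
      (μ.prod μ) := by
    rw [integrable_prod_iff' hmeas]
    constructor
    · filter_upwards [hne] with r hr
      exact ((intervalIntegrable_iff_integrableOn_Ioc_of_le ht).1
        (beta_half_half_extend hr.1 hr.2).1).mul_const (φ r)
    · refine (hφ'.norm.const_mul Real.pi).congr ?_
      filter_upwards [hne] with r hr
      have h1 : ∀ s, ‖(√(t - s))⁻¹ * (√(s - r))⁻¹ * φ r‖
          = (√(t - s))⁻¹ * (√(s - r))⁻¹ * ‖φ r‖ := fun s => by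
        rw [norm_mul, Real.norm_of_nonneg (by positivity : 0 ≤ (√(t - s))⁻¹ * (√(s - r))⁻¹)]
      simp only [Function.uncurry, h1]
      rw [MeasureTheory.integral_mul_const, hμ, ← intervalIntegral.integral_of_le ht,
        (beta_half_half_extend hr.1 hr.2).2]
  have hswap := integral_integral_swap hint
  have hL : abel (abel φ) t = ∫ s, ∫ r, (√(t - s))⁻¹ * (√(s - r))⁻¹ * φ r ∂μ ∂μ := by
    rw [abel, intervalIntegral.integral_of_le ht]
    refine setIntegral_congr_fun measurableSet_Ioc fun s hs => ?_
    simp only [abel, mul_assoc]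
    rw [MeasureTheory.integral_const_mul, intervalIntegral.integral_of_le hs.1.le]
    congr 1
    refine (setIntegral_eq_of_subset_of_forall_sdiff_eq_zero measurableSet_Ioc
      (Set.Ioc_subset_Ioc_right hs.2) fun r hr => ?_).symm
    have : s ≤ r := by
      by_contra! h
      exact hr.2 ⟨hr.1.1, h.le⟩
    rw [Real.sqrt_eq_zero'.2 (sub_nonpos.2 this), inv_zero, zero_mul]
  have hR : ∫ r, ∫ s, (√(t - s))⁻¹ * (√(s - r))⁻¹ * φ r ∂μ ∂μ = ∫ r, Real.pi * φ r ∂μ := by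
    refine MeasureTheory.integral_congr_ae ?_
    filter_upwards [hne] with r hr
    rw [MeasureTheory.integral_mul_const, hμ, ← intervalIntegral.integral_of_le ht,
      (beta_half_half_extend hr.1 hr.2).2]
  rw [hL, hswap, hR, MeasureTheory.integral_const_mul, hμ, ← intervalIntegral.integral_of_le ht]

theorem abel_one {t : ℝ} (ht : 0 ≤ t) : abel (fun _ => 1) t = ∫ s in (0 : ℝ)..t, (√s)⁻¹ := by
  have h1 := abel_abel ht (intervalIntegrable_inv_sqrt 0 t)
  rw [abel_congr ht fun s hs => abel_inv_sqrt hs.1] at h1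
  have h2 : abel (fun _ => Real.pi) t = Real.pi * abel (fun _ => 1) t := by
    rw [abel, abel, ← intervalIntegral.integral_const_mul]
    refine intervalIntegral.integral_congr fun s _ => ?_
    simp only [mul_one]
    exact mul_comm _ _
  rw [h2] at h1
  exact mul_left_cancel₀ Real.pi_ne_zero h1

section Bounded

variable {φ : ℝ → ℝ} {T C : ℝ}

theorem intervalIntegrable_abel_kernel_mul (hφ : ContinuousOn φ (Set.Ioc 0 T))
    (hC : ∀ t ∈ Set.Ioc 0 T, |φ t| ≤ C) {t : ℝ} (ht : t ∈ Set.Icc 0 T) :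
    IntervalIntegrable (fun s => (√(t - s))⁻¹ * φ s) volume 0 t := by
  refine ((intervalIntegrable_inv_sqrt_sub t 0 t).mul_const C).mono_fun'
    (aestronglyMeasurable_kernel_mul (κ := fun τ => (√τ)⁻¹) (by fun_prop) hφ ht) ?_
  refine (ae_restrict_iff' measurableSet_uIoc).2 (Eventually.of_forall fun s hs => ?_)
  rw [Set.uIoc_of_le ht.1] at hs
  simp only [norm_mul]
  rw [Real.norm_of_nonneg (by positivity)]
  exact mul_le_mul_of_nonneg_left (hC s ⟨hs.1, hs.2.trans ht.2⟩) (by positivity)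

theorem abs_abel_le (hC : ∀ t ∈ Set.Ioc 0 T, |φ t| ≤ C) {t : ℝ} (ht : t ∈ Set.Icc 0 T) :
    |abel φ t| ≤ C * ∫ s in (0 : ℝ)..t, (√s)⁻¹ := by
  rw [← abel_one ht.1, abel, abel, ← intervalIntegral.integral_const_mul, ← Real.norm_eq_abs]
  refine norm_integral_le_of_norm_le ht.1 (Eventually.of_forall fun s hs => ?_) ?_
  · rw [norm_mul, Real.norm_of_nonneg (by positivity : 0 ≤ (√(t - s))⁻¹), mul_one, mul_comm]
    exact mul_le_mul_of_nonneg_right (hC s ⟨hs.1, hs.2.trans ht.2⟩) (by positivity)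
  · simpa only [mul_one] using (intervalIntegrable_inv_sqrt_sub t 0 t).const_mul C

theorem exists_abel_bound (hC : ∀ t ∈ Set.Ioc 0 T, |φ t| ≤ C) :
    ∃ D, ∀ t ∈ Set.Ioc 0 T, |abel φ t| ≤ D := by
  refine ⟨C * ∫ s in (0 : ℝ)..T, (√s)⁻¹, fun t ht => ?_⟩
  have hC0 : 0 ≤ C := (abs_nonneg _).trans (hC t ht)
  refine (abs_abel_le hC (Set.Ioc_subset_Icc_self ht)).trans ?_
  refine mul_le_mul_of_nonneg_left ?_ hC0
  exact integral_mono_interval le_rfl ht.1.le ht.2 (Eventually.of_forall fun s => by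
    simp only [Pi.zero_apply]; positivity) (intervalIntegrable_inv_sqrt 0 T)

theorem continuousOn_abel (hφ : ContinuousOn φ (Set.Ioc 0 T))
    (hC : ∀ t ∈ Set.Ioc 0 T, |φ t| ≤ C) : ContinuousOn (abel φ) (Set.Ioc 0 T) := by
  have hmem : ∀ t ∈ Set.Ioc 0 T, ∀ r ∈ Set.uIoc (0 : ℝ) 1, t * r ∈ Set.Ioc 0 T := by
    intro t ht r hr
    rw [Set.uIoc_of_le zero_le_one] at hr
    exact ⟨mul_pos ht.1 hr.1, (mul_le_of_le_one_right ht.1.le hr.2).trans ht.2⟩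
  have h1 : ∀ t ∈ Set.Ioc 0 T,
      abel φ t = t * ((√t)⁻¹ * ∫ r in (0 : ℝ)..1, (√(1 - r))⁻¹ * φ (t * r)) := by
    intro t ht
    have := mul_integral_comp_mul_left (a := 0) (b := 1) (f := fun s => (√(t - s))⁻¹ * φ s) t
    rw [mul_zero, mul_one] at this
    rw [abel, ← this, ← intervalIntegral.integral_const_mul (√t)⁻¹]
    refine congrArg (t * ·) (intervalIntegral.integral_congr fun r _ => ?_)
    have h2 : t - t * r = t * (1 - r) := by ring
    rw [h2, Real.sqrt_mul ht.1.le, mul_inv, mul_assoc]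
  refine ContinuousOn.congr (continuousOn_id.mul (ContinuousOn.mul ?_ ?_)) h1
  · exact Real.continuous_sqrt.continuousOn.inv₀ fun t ht => (Real.sqrt_pos.2 ht.1).ne'
  · intro t ht
    refine continuousWithinAt_of_dominated_interval (bound := fun r => (√(1 - r))⁻¹ * C) ?_ ?_
      ((intervalIntegrable_inv_sqrt_sub 1 0 1).mul_const C) ?_
    · filter_upwards [self_mem_nhdsWithin] with τ hτ
      refine AEStronglyMeasurable.mul (Measurable.aestronglyMeasurable (by fun_prop)) ?_
      exact (hφ.comp (f := fun r => τ * r) (by fun_prop)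
        (hmem τ hτ)).aestronglyMeasurable measurableSet_uIoc
    · filter_upwards [self_mem_nhdsWithin] with τ hτ
      refine Eventually.of_forall fun r hr => ?_
      rw [norm_mul, Real.norm_of_nonneg (by positivity)]
      exact mul_le_mul_of_nonneg_left (hC _ (hmem τ hτ r hr)) (by positivity)
    · refine Eventually.of_forall fun r hr => continuousWithinAt_const.mul ?_
      exact (hφ.comp (f := fun τ => τ * r) (by fun_prop) fun τ hτ => hmem τ hτ r hr) t ht

end Bounded

/-- A bounded solution of the Abel integral equation `f = f₀ + ∫ k - c A f` satisfies the
corresponding half-order differential equation. -/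
theorem deriv_of_abel_equation {f k df : ℝ → ℝ} {T C D f₀ c : ℝ}
    (hf : ContinuousOn f (Set.Ioc 0 T)) (hfC : ∀ t ∈ Set.Ioc 0 T, |f t| ≤ C)
    (hk : ContinuousOn k (Set.Ioc 0 T)) (hkD : ∀ t ∈ Set.Ioc 0 T, |k t| ≤ D)
    (hdf : ∀ t ∈ Set.Ioc 0 T, HasDerivWithinAt f (df t) (Set.Ioc 0 T) t)
    (heq : ∀ t ∈ Set.Ioc 0 T, f t = f₀ + (∫ s in (0 : ℝ)..t, k s) - c * abel f t)
    {t : ℝ} (ht : t ∈ Set.Ioc 0 T) :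
    IntervalIntegrable (fun s => (√(t - s))⁻¹ * df s) volume 0 t ∧
      df t = k t - c * (f₀ * (√t)⁻¹ + abel df t) := by
  have hT : 0 ≤ T := ht.1.le.trans ht.2
  have h0 : (0 : ℝ) ∈ Set.Icc 0 T := ⟨le_rfl, hT⟩
  obtain ⟨M, hM⟩ := exists_abel_bound hkD
  have hAk := continuousOn_abel hk hkD
  have hfi : ∀ {b}, b ∈ Set.Ioc 0 T → IntervalIntegrable f volume 0 b := fun hb =>
    intervalIntegrable_of_continuousOn_bounded hf hfC h0 (Set.Ioc_subset_Icc_self hb)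
  have ik : ∀ {b}, b ∈ Set.Ioc 0 T → IntervalIntegrable k volume 0 b := fun hb =>
    intervalIntegrable_of_continuousOn_bounded hk hkD h0 (Set.Ioc_subset_Icc_self hb)
  have iAk : ∀ {b}, b ∈ Set.Ioc 0 T → IntervalIntegrable (abel k) volume 0 b := fun hb =>
    intervalIntegrable_of_continuousOn_bounded hAk hM h0 (Set.Ioc_subset_Icc_self hb)
  have jf : ∀ {b}, b ∈ Set.Ioc 0 T →
      IntervalIntegrable (fun s => (√(b - s))⁻¹ * f s) volume 0 b := fun hb =>
    intervalIntegrable_abel_kernel_mul hf hfC (Set.Ioc_subset_Icc_self hb)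
  have jk : ∀ {b}, b ∈ Set.Ioc 0 T →
      IntervalIntegrable (fun s => (√(b - s))⁻¹ * k s) volume 0 b := fun hb =>
    intervalIntegrable_abel_kernel_mul hk hkD (Set.Ioc_subset_Icc_self hb)
  have jAk : ∀ {b}, b ∈ Set.Ioc 0 T →
      IntervalIntegrable (fun s => (√(b - s))⁻¹ * abel k s) volume 0 b := fun hb =>
    intervalIntegrable_abel_kernel_mul hAk hM (Set.Ioc_subset_Icc_self hb)
  have jAAk : ∀ {b}, b ∈ Set.Ioc 0 T →
      IntervalIntegrable (fun s => (√(b - s))⁻¹ * abel (abel k) s) volume 0 b := fun hb => by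
    obtain ⟨M', hM'⟩ := exists_abel_bound hM
    exact intervalIntegrable_abel_kernel_mul (continuousOn_abel hAk hM) hM'
      (Set.Ioc_subset_Icc_self hb)
  have jAf : ∀ {b}, b ∈ Set.Ioc 0 T →
      IntervalIntegrable (fun s => (√(b - s))⁻¹ * abel f s) volume 0 b := fun hb => by
    obtain ⟨M', hM'⟩ := exists_abel_bound hfC
    exact intervalIntegrable_abel_kernel_mul (continuousOn_abel hf hfC) hM'
      (Set.Ioc_subset_Icc_self hb)
  have habel : ∀ b ∈ Set.Ioc 0 T, abel f b =
      f₀ * (∫ s in (0 : ℝ)..b, (√s)⁻¹) + (∫ s in (0 : ℝ)..b, abel k s)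
        - c * (Real.pi * ∫ s in (0 : ℝ)..b, f s) := by
    intro b hb
    have h1 : abel f b = ∫ s in (0 : ℝ)..b, (f₀ * ((√(b - s))⁻¹ * 1)
        + Real.pi⁻¹ * ((√(b - s))⁻¹ * abel (abel k) s) - c * ((√(b - s))⁻¹ * abel f s)) := by
      refine integral_congr_ae (Eventually.of_forall fun s hs => ?_)
      rw [Set.uIoc_of_le hb.1.le] at hs
      have hs' : s ∈ Set.Ioc 0 T := ⟨hs.1, hs.2.trans hb.2⟩
      rw [abel_abel hs.1.le (ik hs'), heq s hs']
      field_simp [Real.pi_ne_zero]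
    have j1 : IntervalIntegrable (fun s => (√(b - s))⁻¹ * 1) volume 0 b := by
      simpa only [mul_one] using intervalIntegrable_inv_sqrt_sub b 0 b
    rw [h1, intervalIntegral.integral_sub
      ((j1.const_mul _).add ((jAAk hb).const_mul _)) ((jAf hb).const_mul _),
      intervalIntegral.integral_add (j1.const_mul _) ((jAAk hb).const_mul _),
      intervalIntegral.integral_const_mul, intervalIntegral.integral_const_mul,
      intervalIntegral.integral_const_mul, ← abel_one hb.1.le,
      ← abel_abel hb.1.le (hfi hb)]
    change f₀ * abel (fun _ => 1) b + Real.pi⁻¹ * abel (abel (abel k)) b - c * abel (abel f) b = _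
    rw [abel_abel hb.1.le (iAk hb), inv_mul_cancel_left₀ Real.pi_ne_zero]
  set ψ : ℝ → ℝ := fun s => k s - c * (f₀ * (√s)⁻¹ + abel k s - c * (Real.pi * f s)) with hψ
  have iψ : ∀ {b}, b ∈ Set.Ioc 0 T → IntervalIntegrable ψ volume 0 b := fun hb =>
    (ik hb).sub (((((intervalIntegrable_inv_sqrt 0 _).const_mul f₀).add (iAk hb)).sub
      (((hfi hb).const_mul _).const_mul c)).const_mul c)
  have hfψ : ∀ b ∈ Set.Ioc 0 T, f b = f₀ + ∫ s in (0 : ℝ)..b, ψ s := by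
    intro b hb
    rw [heq b hb, habel b hb, hψ, intervalIntegral.integral_sub (ik hb)
      (((((intervalIntegrable_inv_sqrt 0 _).const_mul f₀).add (iAk hb)).sub
      (((hfi hb).const_mul _).const_mul c)).const_mul c),
      intervalIntegral.integral_const_mul, intervalIntegral.integral_sub
      (((intervalIntegrable_inv_sqrt 0 _).const_mul f₀).add (iAk hb))
      (((hfi hb).const_mul _).const_mul c), intervalIntegral.integral_add
      ((intervalIntegrable_inv_sqrt 0 _).const_mul f₀) (iAk hb)]
    simp only [intervalIntegral.integral_const_mul]
    ring
  have hψc : ContinuousOn ψ (Set.Ioc 0 T) := by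
    have h2 : ContinuousOn (fun s : ℝ => (√s)⁻¹) (Set.Ioc 0 T) :=
      Real.continuous_sqrt.continuousOn.inv₀ fun t ht => (Real.sqrt_pos.2 ht.1).ne'
    exact hk.sub (continuousOn_const.mul (((continuousOn_const.mul h2).add hAk).sub
      (continuousOn_const.mul (continuousOn_const.mul hf))))
  have hdfψ : ∀ b ∈ Set.Ioc 0 T, df b = ψ b := by
    intro b hb
    have hsub : Set.Ioc 0 b ⊆ Set.Ioc 0 T := Set.Ioc_subset_Ioc_right hb.2
    have h1 := (hdf b hb).mono hsub
    have h2 : HasDerivWithinAt f (ψ b) (Set.Ioc 0 b) b :=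
      (((hasDerivWithinAt_integral_Iic hb hψc (iψ hb)).const_add f₀).mono
        (fun s hs => hs.2)).congr (fun s hs => hfψ s (hsub hs)) (hfψ b hb)
    exact (uniqueDiffOn_Ioc 0 b b ⟨hb.1, le_rfl⟩).eq_deriv _ h1 h2
  have jb : IntervalIntegrable (fun s => (√(t - s))⁻¹ * (√s)⁻¹) volume 0 t := by
    simpa only [sub_zero] using (beta_half_half ht.1).1
  have hψexp : ∀ s, (√(t - s))⁻¹ * ψ s = (√(t - s))⁻¹ * k s - c * (f₀ * ((√(t - s))⁻¹ * (√s)⁻¹)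
      + (√(t - s))⁻¹ * abel k s - c * (Real.pi * ((√(t - s))⁻¹ * f s))) := fun s => by
    rw [hψ]; ring
  have jψ2 := (((jb.const_mul f₀).add (jAk ht)).sub
      (((jf ht).const_mul Real.pi).const_mul c))
  have hmul : ∀ s ∈ Set.uIoc 0 t, (√(t - s))⁻¹ * df s = (√(t - s))⁻¹ * ψ s := by
    intro s hs
    rw [Set.uIoc_of_le ht.1.le] at hs
    rw [hdfψ s ⟨hs.1, hs.2.trans ht.2⟩]
  have jψ : IntervalIntegrable (fun s => (√(t - s))⁻¹ * ψ s) volume 0 t := by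
    simp only [hψexp]
    exact (jk ht).sub (jψ2.const_mul c)
  refine ⟨jψ.congr fun s hs => (hmul s hs).symm, ?_⟩
  have hA : abel df t = abel k t - c * Real.pi * f t := by
    have h1 : abel df t = ∫ s in (0 : ℝ)..t, (√(t - s))⁻¹ * ψ s :=
      integral_congr_ae (Eventually.of_forall hmul)
    rw [h1]
    simp only [hψexp]
    rw [intervalIntegral.integral_sub (jk ht) (jψ2.const_mul c),
      intervalIntegral.integral_const_mul,
      intervalIntegral.integral_sub ((jb.const_mul f₀).add (jAk ht))
        (((jf ht).const_mul Real.pi).const_mul c),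
      intervalIntegral.integral_add (jb.const_mul f₀) (jAk ht)]
    simp only [intervalIntegral.integral_const_mul]
    change abel k t - c * (f₀ * abel (fun s => (√s)⁻¹) t + abel (abel k) t
      - c * (Real.pi * abel f t)) = _
    rw [abel_inv_sqrt ht.1, abel_abel ht.1.le (ik ht), heq t ht]
    ring
  rw [hA, hdfψ t ht, hψ]
  ring

theorem heatKernel_zero {τ : ℝ} : heatKernel 0 τ = (√Real.pi)⁻¹ * (√τ)⁻¹ := by
  rw [heatKernel, Real.sqrt_mul Real.pi_pos.le, mul_inv]
  simp

theorem integral_heatKernel_zero (f : ℝ → ℝ) (t : ℝ) :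
    ∫ s in (0 : ℝ)..t, -heatKernel 0 (t - s) * f s = -((√Real.pi)⁻¹ * abel f t) := by
  rw [abel, ← intervalIntegral.integral_const_mul, ← intervalIntegral.integral_neg]
  refine intervalIntegral.integral_congr fun s _ => ?_
  simp only [heatKernel_zero]
  ring

theorem tendsto_integral_right_zero {g : ℝ → ℝ} {T : ℝ} (hT : 0 < T)
    (hg : IntervalIntegrable g volume 0 T) :
    Tendsto (fun ε => ∫ s in (0 : ℝ)..ε, g s) (𝓝[>] 0) (𝓝 0) := by
  have h := continuousOn_primitive_interval' hg Set.left_mem_uIcc 0 Set.left_mem_uIcc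
  rw [ContinuousWithinAt, integral_same, Set.uIcc_of_le hT.le] at h
  rw [← nhdsWithin_Ioc_eq_nhdsGT hT]
  exact h.mono_left (nhdsWithin_mono _ Set.Ioc_subset_Icc_self)

theorem tendsto_abel_zero {f : ℝ → ℝ} {T C : ℝ} (hT : 0 < T)
    (hC : ∀ t ∈ Set.Ioc 0 T, |f t| ≤ C) : Tendsto (abel f) (𝓝[>] 0) (𝓝 0) := by
  have h := (tendsto_integral_right_zero hT (intervalIntegrable_inv_sqrt 0 T)).const_mul C
  rw [mul_zero] at h
  refine squeeze_zero_norm' ?_ h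
  filter_upwards [Ioc_mem_nhdsGT hT] with ε hε
  exact abs_abel_le hC (Set.Ioc_subset_Icc_self hε)

/-- A bounded heat solution on the half line with zero initial data and a Robin-type dynamic
boundary condition satisfies the half-order equation at the boundary. -/
theorem HeatSolution.boundary_equation {T C D γ f₀ : ℝ} {q p r : ℝ → ℝ → ℝ}
    (h : HeatSolution T C q p r) {df qx k : ℝ → ℝ}
    (hdf : ∀ t ∈ Set.Ioc 0 T, HasDerivWithinAt (q 0) (df t) (Set.Ioc 0 T) t)
    (hdfc : ContinuousOn df (Set.Ioc 0 T))
    (hqx : ∀ t ∈ Set.Ioc 0 T, HasDerivWithinAt (fun x => q x t) (qx t) (Set.Ici 0) 0)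
    (hk : ContinuousOn k (Set.Ioc 0 T)) (hkD : ∀ t ∈ Set.Ioc 0 T, |k t| ≤ D)
    (hbc : ∀ t ∈ Set.Ioc 0 T, df t = k t + γ * qx t)
    (hlim : Tendsto (q 0) (𝓝[>] 0) (𝓝 f₀)) {t : ℝ} (ht : t ∈ Set.Ioc 0 T) :
    IntervalIntegrable (fun s => (√(t - s))⁻¹ * df s) volume 0 t ∧
      df t = k t - γ * (√Real.pi)⁻¹ * (f₀ * (√t)⁻¹ + abel df t) := by
  have hf := h.continuousOn_time' le_rfl
  have hC := h.bdd' le_rfl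
  refine deriv_of_abel_equation hf hC hk hkD hdf (fun t ht => ?_) ht
  have hT : 0 < T := ht.1.trans_le ht.2
  have h0 : (0 : ℝ) ∈ Set.Icc 0 T := ⟨le_rfl, hT.le⟩
  have ik : ∀ {a b}, a ∈ Set.Icc 0 T → b ∈ Set.Icc 0 T → IntervalIntegrable k volume a b :=
    fun ha hb => intervalIntegrable_of_continuousOn_bounded hk hkD ha hb
  have key : ∀ ε ∈ Set.Ioc 0 t, q 0 t - q 0 ε = (∫ s in (0 : ℝ)..t, k s)
      - (∫ s in (0 : ℝ)..ε, k s)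
      - γ * (√Real.pi)⁻¹ * (abel (q 0) t - abel (q 0) ε) := by
    intro ε hε
    have hεT : ε ∈ Set.Icc 0 T := ⟨hε.1.le, hε.2.trans ht.2⟩
    have hsub : Set.Icc ε t ⊆ Set.Ioc 0 T := fun s hs =>
      ⟨hε.1.trans_le hs.1, hs.2.trans ht.2⟩
    have idf : IntervalIntegrable df volume ε t :=
      (hdfc.mono (by rwa [Set.uIcc_of_le hε.2])).intervalIntegrable
    have h1 : ∫ s in ε..t, df s = q 0 t - q 0 ε :=
      integral_eq_sub_of_hasDerivAt_of_le hε.2 (hf.mono hsub) (fun s hs =>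
        (hdf s (hsub (Set.Ioo_subset_Icc_self hs))).hasDerivAt
          (Ioc_mem_nhds (hε.1.trans hs.1) (hs.2.trans_le ht.2))) idf
    have h2 : γ * ∫ s in ε..t, qx s = (∫ s in ε..t, df s) - ∫ s in ε..t, k s := by
      rw [← intervalIntegral.integral_const_mul, ← intervalIntegral.integral_sub idf
        (ik hεT (Set.Ioc_subset_Icc_self ht))]
      refine intervalIntegral.integral_congr fun s hs => ?_
      rw [Set.uIcc_of_le hε.2] at hs
      rw [hbc s (hsub hs)]
      ring
    rw [h.integral_flux hdf hdfc hqx hε.1 hε.2 ht.2, integral_heatKernel_zero,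
      integral_heatKernel_zero, h1, ← intervalIntegral.integral_interval_sub_left
        (ik h0 (Set.Ioc_subset_Icc_self ht)) (ik h0 hεT)] at h2
    linear_combination -h2
  have hL : Tendsto (fun ε => q 0 t - q 0 ε) (𝓝[>] 0) (𝓝 (q 0 t - f₀)) := hlim.const_sub _
  have hR : Tendsto (fun ε => (∫ s in (0 : ℝ)..t, k s) - (∫ s in (0 : ℝ)..ε, k s)
      - γ * (√Real.pi)⁻¹ * (abel (q 0) t - abel (q 0) ε)) (𝓝[>] 0)
      (𝓝 ((∫ s in (0 : ℝ)..t, k s) - 0 - γ * (√Real.pi)⁻¹ * (abel (q 0) t - 0))) :=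
    ((tendsto_integral_right_zero hT (ik h0 ⟨hT.le, le_rfl⟩)).const_sub _).sub
      (((tendsto_abel_zero hT hC).const_sub _).const_mul _)
  have := tendsto_nhds_unique (hL.congr' (by
    filter_upwards [Ioc_mem_nhdsGT ht.1] with ε hε using key ε hε)) hR
  linear_combination this

section Slices

variable {E : Type*} [NormedAddCommGroup E] [NormedSpace ℝ E] {G : ℝ × ℝ → E} {T x t : ℝ}

theorem uniqueDiffOn_Ioi_prod_Ioc (T : ℝ) :
    UniqueDiffOn ℝ (Set.Ioi (0 : ℝ) ×ˢ Set.Ioc 0 T) :=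
  isOpen_Ioi.uniqueDiffOn.prod (uniqueDiffOn_Ioc 0 T)

theorem hasDerivAt_slice_fst (hG : DifferentiableOn ℝ G (Set.Ioi 0 ×ˢ Set.Ioc 0 T)) (hx : 0 < x)
    (ht : t ∈ Set.Ioc 0 T) :
    HasDerivAt (fun ξ => G (ξ, t))
      (fderivWithin ℝ G (Set.Ioi 0 ×ˢ Set.Ioc 0 T) (x, t) (1, 0)) x := by
  have h1 : HasDerivWithinAt (fun ξ : ℝ => (ξ, t)) (1, 0) (Set.Ioi 0) x :=
    (hasDerivWithinAt_id x _).prodMk (hasDerivWithinAt_const x _ t)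
  have h2 : Set.MapsTo (fun ξ : ℝ => (ξ, t)) (Set.Ioi 0) (Set.Ioi 0 ×ˢ Set.Ioc 0 T) :=
    fun ξ hξ => ⟨hξ, ht⟩
  exact ((hG (x, t) ⟨hx, ht⟩).hasFDerivWithinAt.comp_hasDerivWithinAt x h1 h2).hasDerivAt (Ioi_mem_nhds hx)

theorem hasDerivWithinAt_slice_snd (hG : DifferentiableOn ℝ G (Set.Ioi 0 ×ˢ Set.Ioc 0 T))
    (hx : 0 < x) (ht : t ∈ Set.Ioc 0 T) :
    HasDerivWithinAt (fun τ => G (x, τ))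
      (fderivWithin ℝ G (Set.Ioi 0 ×ˢ Set.Ioc 0 T) (x, t) (0, 1)) (Set.Ioc 0 T) t := by
  have h1 : HasDerivWithinAt (fun τ : ℝ => (x, τ)) (0, 1) (Set.Ioc 0 T) t :=
    (hasDerivWithinAt_const t _ x).prodMk (hasDerivWithinAt_id t _)
  exact (hG (x, t) ⟨hx, ht⟩).hasFDerivWithinAt.comp_hasDerivWithinAt t h1 fun τ hτ => ⟨hx, hτ⟩

end Slices

/-- A scalar component of a smooth bounded vector-valued heat solution. -/
theorem exists_heatSolution {E : Type*} [NormedAddCommGroup E] [NormedSpace ℝ E] {T C : ℝ}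
    {q : ℝ → ℝ → E} (L : E →L[ℝ] ℝ) (hL : ∀ v, |L v| ≤ ‖v‖)
    (hbdd : ∀ x ∈ Set.Ici (0 : ℝ), ∀ t ∈ Set.Icc (0 : ℝ) T, ‖q x t‖ ≤ C)
    (hcont : ContinuousOn (fun p : ℝ × ℝ => q p.1 p.2)
      ((Set.Ioi 0 ×ˢ Set.Icc 0 T) ∪ ({0} ×ˢ Set.Ioc 0 T)))
    (hsmooth : ContDiffOn ℝ (⊤ : ℕ∞) (fun p : ℝ × ℝ => q p.1 p.2) (Set.Ioi 0 ×ˢ Set.Ioc 0 T))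
    (hheat : ∀ x ∈ Set.Ioi (0 : ℝ), ∀ t ∈ Set.Ioc (0 : ℝ) T,
      derivWithin (fun τ => q x τ) (Set.Ioc 0 T) t = deriv (deriv (fun ξ => q ξ t)) x)
    (hinit : ∀ x > (0 : ℝ), q x 0 = 0) :
    ∃ p r, HeatSolution T C (fun x t => L (q x t)) p r := by
  set A : Set (ℝ × ℝ) := Set.Ioi 0 ×ˢ Set.Ioc 0 T with hA
  have huA : UniqueDiffOn ℝ A := uniqueDiffOn_Ioi_prod_Ioc T
  set G : ℝ × ℝ → E := fun p => q p.1 p.2 with hGdef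
  set P : ℝ × ℝ → E := fun z => fderivWithin ℝ G A z (1, 0) with hPdef
  set N : ℝ × ℝ → E := fun z => fderivWithin ℝ P A z (1, 0) with hNdef
  have hP : ContDiffOn ℝ 1 P A :=
    ((hsmooth.of_le (WithTop.coe_le_coe.2 (le_top : (2 : ℕ∞) ≤ ⊤))).fderivWithin (m := 1) (n := 2) huA
      (by norm_num)).clm_apply contDiffOn_const
  have hN : ContinuousOn N A :=
    (hP.continuousOn_fderivWithin huA le_rfl).clm_apply continuousOn_const
  have hGd : DifferentiableOn ℝ G A := hsmooth.differentiableOn (by simp)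
  have hPd : DifferentiableOn ℝ P A := hP.differentiableOn (by simp)
  have hqx : ∀ x > 0, ∀ t ∈ Set.Ioc 0 T, HasDerivAt (fun ξ => q ξ t) (P (x, t)) x :=
    fun x hx t ht => hasDerivAt_slice_fst hGd hx ht
  have hqxx : ∀ x > 0, ∀ t ∈ Set.Ioc 0 T, HasDerivAt (fun ξ => P (ξ, t)) (N (x, t)) x :=
    fun x hx t ht => hasDerivAt_slice_fst hPd hx ht
  have hqt : ∀ x > 0, ∀ t ∈ Set.Ioc 0 T, HasDerivWithinAt (q x) (N (x, t)) (Set.Ioc 0 T) t := by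
    intro x hx t ht
    have h1 : deriv (deriv fun ξ => q ξ t) x = N (x, t) := by
      rw [← (hqxx x hx t ht).deriv]
      refine EventuallyEq.deriv_eq ?_
      filter_upwards [Ioi_mem_nhds hx] with ξ hξ using (hqx ξ hξ t ht).deriv
    rw [← h1, ← hheat x hx t ht]
    exact (hasDerivWithinAt_slice_snd hGd hx ht).differentiableWithinAt.hasDerivWithinAt
  exact ⟨fun x t => L (P (x, t)), fun x t => L (N (x, t)),
    { bdd := fun x hx t ht => (hL _).trans (hbdd x hx t ht)
      cont := L.continuous.comp_continuousOn hcont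
      cont_x := L.continuous.comp_continuousOn hP.continuousOn
      cont_xx := L.continuous.comp_continuousOn hN
      deriv_x := fun x hx t ht => L.hasFDerivAt.comp_hasDerivAt x (hqx x hx t ht)
      deriv_xx := fun x hx t ht => L.hasFDerivAt.comp_hasDerivAt x (hqxx x hx t ht)
      deriv_t := fun x hx t ht => L.hasFDerivAt.comp_hasDerivWithinAt t (hqt x hx t ht)
      initial := fun x hx => by simp [hinit x hx] }⟩

/-- The half-order boundary equation for a planar bounded heat solution on the half line. -/
theorem boundary_equation_prod {T C D γ : ℝ} {q : ℝ → ℝ → ℝ × ℝ} {df qx k : ℝ → ℝ × ℝ}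
    {f₀ : ℝ × ℝ}
    (hq : ∀ L : ℝ × ℝ →L[ℝ] ℝ, (∀ v, |L v| ≤ ‖v‖) →
      ∃ p r, HeatSolution T C (fun x t => L (q x t)) p r)
    (hdf : ∀ t ∈ Set.Ioc 0 T, HasDerivWithinAt (q 0) (df t) (Set.Ioc 0 T) t)
    (hdfc : ContinuousOn df (Set.Ioc 0 T))
    (hqx : ∀ t ∈ Set.Ioc 0 T, HasDerivWithinAt (fun x => q x t) (qx t) (Set.Ici 0) 0)
    (hk : ContinuousOn k (Set.Ioc 0 T)) (hkD : ∀ t ∈ Set.Ioc 0 T, ‖k t‖ ≤ D)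
    (hbc : ∀ t ∈ Set.Ioc 0 T, df t = k t + γ • qx t)
    (hlim : Tendsto (q 0) (𝓝[>] 0) (𝓝 f₀)) {t : ℝ} (ht : t ∈ Set.Ioc 0 T) :
    df t = k t - (γ * (√Real.pi)⁻¹) •
      ((√t)⁻¹ • f₀ + ∫ s in (0 : ℝ)..t, (√(t - s))⁻¹ • df s) := by
  have key : ∀ L : ℝ × ℝ →L[ℝ] ℝ, (∀ v, |L v| ≤ ‖v‖) →
      IntervalIntegrable (fun s => (√(t - s))⁻¹ * L (df s)) volume 0 t ∧
        L (df t) = L (k t) - γ * (√Real.pi)⁻¹ *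
          (L f₀ * (√t)⁻¹ + abel (fun s => L (df s)) t) := by
    intro L hL
    obtain ⟨p, r, h⟩ := hq L hL
    exact h.boundary_equation (df := fun s => L (df s)) (qx := fun s => L (qx s))
      (k := fun s => L (k s))
      (fun s hs => L.hasFDerivAt.comp_hasDerivWithinAt s (hdf s hs))
      (L.continuous.comp_continuousOn hdfc)
      (fun s hs => L.hasFDerivAt.comp_hasDerivWithinAt 0 (hqx s hs))
      (L.continuous.comp_continuousOn hk) (fun s hs => (hL _).trans (hkD s hs))
      (fun s hs => by rw [hbc s hs, map_add, map_smul, smul_eq_mul])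
      ((L.continuous.tendsto f₀).comp hlim) ht
  obtain ⟨i1, e1⟩ := key (.fst ℝ ℝ ℝ) norm_fst_le
  obtain ⟨i2, e2⟩ := key (.snd ℝ ℝ ℝ) norm_snd_le
  have hi : IntervalIntegrable (fun s => (√(t - s))⁻¹ • df s) volume 0 t :=
    ⟨i1.1.prodMk i2.1, i1.2.prodMk i2.2⟩
  have hcomp : ∀ L : ℝ × ℝ →L[ℝ] ℝ,
      L (∫ s in (0 : ℝ)..t, (√(t - s))⁻¹ • df s) = abel (fun s => L (df s)) t := fun L => by
    rw [← L.intervalIntegral_comp_comm hi]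
    simp only [map_smul, smul_eq_mul, abel]
  rw [← hcomp] at e1 e2
  refine Prod.ext ?_ ?_
  · simpa only [Prod.fst_sub, Prod.smul_fst, Prod.fst_add, smul_eq_mul,
      ContinuousLinearMap.coe_fst', mul_comm _ (√t)⁻¹] using e1
  · simpa only [Prod.snd_sub, Prod.smul_snd, Prod.snd_add, smul_eq_mul,
      ContinuousLinearMap.coe_snd', mul_comm _ (√t)⁻¹] using e2

section Flow

variable {u : ℝ × ℝ → ℝ → ℝ × ℝ}

theorem deriv_flow_time (hu : ContDiff ℝ 2 (fun p : (ℝ × ℝ) × ℝ => u p.1 p.2)) (x : ℝ × ℝ)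
    (t : ℝ) : deriv (fun τ => u x τ) t =
      fderiv ℝ (fun p : (ℝ × ℝ) × ℝ => u p.1 p.2) (x, t) (0, 1) := by
  have h1 : HasDerivAt (fun τ : ℝ => (x, τ)) (0, 1) t :=
    (hasDerivAt_const t x).prodMk (hasDerivAt_id t)
  exact (((hu.differentiable two_ne_zero) (x, t)).hasFDerivAt.comp_hasDerivAt t h1).deriv

theorem fderiv_flow_space (hu : ContDiff ℝ 2 (fun p : (ℝ × ℝ) × ℝ => u p.1 p.2)) (x : ℝ × ℝ)
    (t : ℝ) (w : ℝ × ℝ) : fderiv ℝ (fun p => u p t) x w =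
      fderiv ℝ (fun p : (ℝ × ℝ) × ℝ => u p.1 p.2) (x, t) (w, 0) := by
  have h1 : HasFDerivAt (𝕜 := ℝ) (fun p : ℝ × ℝ => (p, t)) _ x :=
    (hasFDerivAt_id x).prodMk (hasFDerivAt_const t x)
  have h2 := (((hu.differentiable two_ne_zero) (x, t)).hasFDerivAt.comp x h1).fderiv
  exact congrArg (fun A : ℝ × ℝ →L[ℝ] ℝ × ℝ => A w) h2

theorem hasDerivWithinAt_flow (hu : ContDiff ℝ 2 (fun p : (ℝ × ℝ) × ℝ => u p.1 p.2))
    {y : ℝ → ℝ × ℝ} {w : ℝ × ℝ} {s : Set ℝ} {t : ℝ} (hy : HasDerivWithinAt y w s t) :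
    HasDerivWithinAt (fun σ => u (y σ) σ)
      (deriv (fun τ => u (y t) τ) t + fderiv ℝ (fun p => u p t) (y t) w) s t := by
  have h1 : HasDerivWithinAt (fun σ => (y σ, σ)) (w, 1) s t := hy.prodMk (hasDerivWithinAt_id t s)
  have h2 := ((hu.differentiable two_ne_zero) (y t, t)).hasFDerivAt.comp_hasDerivWithinAt
    (f := fun σ => (y σ, σ)) t h1
  have h3 : ((0 : ℝ × ℝ), (1 : ℝ)) + (w, 0) = (w, 1) := by simp
  rw [deriv_flow_time hu, fderiv_flow_space hu, ← map_add, h3]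
  exact h2

theorem norm_forcing_le {a b M₁ M₂ C : ℝ} {m w : ℝ × ℝ} {A : (ℝ × ℝ) × ℝ →L[ℝ] ℝ × ℝ}
    (hm : ‖m‖ ≤ M₁) (hA : ‖A‖ ≤ M₂) (hw : ‖w‖ ≤ C) :
    ‖a • m - A (w, 0) - b • w‖ ≤ ‖a‖ * M₁ + M₂ * C + ‖b‖ * C := by
  have h1 : ‖a • m‖ ≤ ‖a‖ * M₁ := by
    rw [norm_smul]
    exact mul_le_mul_of_nonneg_left hm (norm_nonneg _)
  have h2 : ‖A (w, 0)‖ ≤ M₂ * C := by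
    refine (A.le_of_opNorm_le hA _).trans ?_
    refine mul_le_mul_of_nonneg_left ?_ ((norm_nonneg _).trans hA)
    rwa [Prod.norm_mk, norm_zero, max_eq_left (norm_nonneg _)]
  have h3 : ‖b • w‖ ≤ ‖b‖ * C := by
    rw [norm_smul]
    exact mul_le_mul_of_nonneg_left hw (norm_nonneg _)
  have h4 := norm_sub_le (a • m - A (w, 0)) (b • w)
  have h5 := norm_sub_le (a • m) (A (w, 0))
  linarith

end Flow

/-- A solution of Prasath–Vasan–Govindarajan's reformulated system (heat equation in a
pseudo-space variable with nonlinear Robin boundary condition and trajectory coupling)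
yields a solution of the Maxey–Riley equations with Basset history term. -/
theorem reformulated_system_solves_maxey_riley
    (T : ℝ) (hT : 0 < T)
    (u : ℝ × ℝ → ℝ → ℝ × ℝ)
    (hu : ContDiff ℝ 2 (fun p : (ℝ × ℝ) × ℝ => u p.1 p.2))
    (R S : ℝ) (hR : 0 < R) (hS : 0 < S)
    (α γ : ℝ) (hα : α = 1 / (R * S)) (hγ : γ = (1 / R) * Real.sqrt (3 / S))
    (y₀ v₀ : ℝ × ℝ)
    (q : ℝ → ℝ → ℝ × ℝ)
    (hbdd : ∃ C, ∀ x ∈ Set.Ici (0 : ℝ), ∀ t ∈ Set.Icc (0 : ℝ) T, ‖q x t‖ ≤ C)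
    (hcont : ContinuousOn (fun p : ℝ × ℝ => q p.1 p.2)
      ((Set.Ioi 0 ×ˢ Set.Icc 0 T) ∪ ({0} ×ˢ Set.Ioc 0 T)))
    (hsmooth : ContDiffOn ℝ (⊤ : ℕ∞) (fun p : ℝ × ℝ => q p.1 p.2) (Set.Ioi 0 ×ˢ Set.Ioc 0 T))
    (hheat : ∀ x ∈ Set.Ioi (0 : ℝ), ∀ t ∈ Set.Ioc (0 : ℝ) T,
      derivWithin (fun τ => q x τ) (Set.Ioc 0 T) t = deriv (deriv (fun ξ => q ξ t)) x)
    (hinit : ∀ x > (0 : ℝ), q x 0 = 0)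
    (qx : ℝ → ℝ × ℝ)
    (hqx : ∀ t ∈ Set.Ioc (0 : ℝ) T,
      HasDerivWithinAt (fun x => q x t) (qx t) (Set.Ici 0) 0)
    (hq0 : ContDiffOn ℝ 1 (fun t => q 0 t) (Set.Ioc 0 T))
    (hq0lim : Tendsto (fun t => q 0 t) (nhdsWithin 0 (Set.Ioi 0)) (nhds (v₀ - u y₀ 0)))
    (y : ℝ → ℝ × ℝ) (hy0 : y 0 = y₀)
    (hy : ∀ t ∈ Set.Icc (0 : ℝ) T,
      HasDerivWithinAt y (q 0 t + u (y t) t) (Set.Icc 0 T) t)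
    (hbc : ∀ t ∈ Set.Ioc (0 : ℝ) T,
      derivWithin (fun τ => q 0 τ) (Set.Ioc 0 T) t + α • q 0 t - γ • qx t
        = (1 / R - 1) •
            (deriv (fun τ => u (y t) τ) t
              + fderiv ℝ (fun p => u p t) (y t) (u (y t) t))
          - fderiv ℝ (fun p => u p t) (y t) (q 0 t)) :
    (∀ t ∈ Set.Ioc (0 : ℝ) T,
      R • derivWithin (fun s => q 0 s + u (y s) s) (Set.Icc 0 T) t
        = (deriv (fun τ => u (y t) τ) t
            + fderiv ℝ (fun p => u p t) (y t) (u (y t) t))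
          - (1 / S) • ((q 0 t + u (y t) t) - u (y t) t)
          - Real.sqrt (3 / (Real.pi * S)) •
              ((Real.sqrt t)⁻¹ • (v₀ - u y₀ 0)
                + ∫ s in (0 : ℝ)..t,
                    (Real.sqrt (t - s))⁻¹ •
                      (derivWithin (fun σ => q 0 σ + u (y σ) σ) (Set.Icc 0 T) s
                        - derivWithin (fun σ => u (y σ) σ) (Set.Icc 0 T) s))) ∧
    (∀ t ∈ Set.Icc (0 : ℝ) T,
      HasDerivWithinAt y (q 0 t + u (y t) t) (Set.Icc 0 T) t) := by
  refine ⟨fun t ht => ?_, hy⟩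
  obtain ⟨C, hC⟩ := hbdd
  set df : ℝ → ℝ × ℝ := fun t => derivWithin (fun τ => q 0 τ) (Set.Ioc 0 T) t with hdf_def
  set U : (ℝ × ℝ) × ℝ → ℝ × ℝ := fun p => u p.1 p.2 with hU
  have hdf : ∀ t ∈ Set.Ioc 0 T, HasDerivWithinAt (q 0) (df t) (Set.Ioc 0 T) t := fun t ht =>
    ((hq0.differentiableOn one_ne_zero) t ht).hasDerivWithinAt
  have hdfc : ContinuousOn df (Set.Ioc 0 T) :=
    hq0.continuousOn_derivWithin (uniqueDiffOn_Ioc 0 T) le_rfl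
  have hyc : ContinuousOn (fun s => (y s, s)) (Set.Icc 0 T) :=
    ContinuousOn.prodMk (fun s hs => (hy s hs).continuousWithinAt) continuousOn_id
  have hDU : ContinuousOn (fun s => fderiv ℝ U (y s, s)) (Set.Icc 0 T) :=
    (hu.continuous_fderiv two_ne_zero).comp_continuousOn hyc
  have hUc : ContinuousOn (fun s => u (y s) s) (Set.Icc 0 T) :=
    hu.continuous.comp_continuousOn hyc
  -- the material derivative along the trajectory and the resulting forcing
  set m : ℝ → ℝ × ℝ := fun s => fderiv ℝ U (y s, s) (0, 1) + fderiv ℝ U (y s, s) (u (y s) s, 0)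
    with hm
  have hmat : ∀ s, deriv (fun τ => u (y s) τ) s + fderiv ℝ (fun p => u p s) (y s) (u (y s) s)
      = m s := fun s => by rw [deriv_flow_time hu, fderiv_flow_space hu]
  set k : ℝ → ℝ × ℝ := fun s => (1 / R - 1) • m s - fderiv ℝ U (y s, s) (q 0 s, 0) - α • q 0 s
    with hk_def
  have hmc : ContinuousOn m (Set.Icc 0 T) :=
    (hDU.clm_apply continuousOn_const).add (hDU.clm_apply (hUc.prodMk continuousOn_const))
  have hk : ContinuousOn k (Set.Ioc 0 T) := by
    have h1 : ContinuousOn (fun s => (1 / R - 1) • m s) (Set.Ioc 0 T) :=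
      (hmc.mono Set.Ioc_subset_Icc_self).const_smul (1 / R - 1)
    have h2 : ContinuousOn (fun s => fderiv ℝ U (y s, s) (q 0 s, 0)) (Set.Ioc 0 T) :=
      (hDU.mono Set.Ioc_subset_Icc_self).clm_apply (hq0.continuousOn.prodMk continuousOn_const)
    have h3 : ContinuousOn (fun s => α • q 0 s) (Set.Ioc 0 T) :=
      hq0.continuousOn.const_smul α
    exact (h1.sub h2).sub h3
  obtain ⟨M₁, hM₁⟩ := isCompact_Icc.exists_bound_of_continuousOn hmc
  obtain ⟨M₂, hM₂⟩ := isCompact_Icc.exists_bound_of_continuousOn hDU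
  have hkD : ∀ s ∈ Set.Ioc 0 T, ‖k s‖ ≤ ‖1 / R - 1‖ * M₁ + M₂ * C + ‖α‖ * C := by
    intro s hs
    have hs' := Set.Ioc_subset_Icc_self hs
    exact norm_forcing_le (hM₁ s hs') (hM₂ s hs') (hC 0 Set.self_mem_Ici s hs')
  have hbc' : ∀ s ∈ Set.Ioc 0 T, df s = k s + γ • qx s := by
    intro s hs
    have h := hbc s hs
    rw [hmat, fderiv_flow_space hu] at h
    rw [hk_def]
    simp only
    rw [← h]
    module
  have main := boundary_equation_prod
    (fun L hL => exists_heatSolution L hL hC hcont hsmooth hheat hinit)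
    hdf hdfc hqx hk hkD hbc' hq0lim ht
  have hdf' : ∀ s ∈ Set.Ioc 0 T, HasDerivWithinAt (q 0) (df s) (Set.Icc 0 T) s := fun s hs =>
    (hdf s hs).mono_of_mem_nhdsWithin (by
      filter_upwards [self_mem_nhdsWithin, mem_nhdsWithin_of_mem_nhds (Ioi_mem_nhds hs.1)]
        with τ hτ hτ' using ⟨hτ', hτ.2⟩)
  have huniq : UniqueDiffOn ℝ (Set.Icc 0 T) := uniqueDiffOn_Icc hT
  have hflow : ∀ s ∈ Set.Icc 0 T, HasDerivWithinAt (fun σ => u (y σ) σ)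
      (m s + fderiv ℝ U (y s, s) (q 0 s, 0)) (Set.Icc 0 T) s := by
    intro s hs
    have h := hasDerivWithinAt_flow hu (hy s hs)
    rw [add_comm (q 0 s), map_add, ← add_assoc, hmat, fderiv_flow_space hu] at h
    exact h
  have hv : ∀ s ∈ Set.Ioc 0 T, derivWithin (fun σ => q 0 σ + u (y σ) σ) (Set.Icc 0 T) s
      = df s + (m s + fderiv ℝ U (y s, s) (q 0 s, 0)) := fun s hs =>
    ((hdf' s hs).add (hflow s (Set.Ioc_subset_Icc_self hs))).derivWithin
      (huniq s (Set.Ioc_subset_Icc_self hs))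
  have hint : ∫ s in (0 : ℝ)..t, (√(t - s))⁻¹ •
      (derivWithin (fun σ => q 0 σ + u (y σ) σ) (Set.Icc 0 T) s
        - derivWithin (fun σ => u (y σ) σ) (Set.Icc 0 T) s)
      = ∫ s in (0 : ℝ)..t, (√(t - s))⁻¹ • df s := by
    refine integral_congr_ae (Eventually.of_forall fun s hs => ?_)
    rw [Set.uIoc_of_le ht.1.le] at hs
    have hs' : s ∈ Set.Ioc 0 T := ⟨hs.1, hs.2.trans ht.2⟩
    rw [hv s hs', (hflow s (Set.Ioc_subset_Icc_self hs')).derivWithin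
      (huniq s (Set.Ioc_subset_Icc_self hs')), add_sub_cancel_right]
  have hcoef : R * (γ * (√Real.pi)⁻¹) = √(3 / (Real.pi * S)) := by
    rw [hγ, mul_comm Real.pi S, ← div_div, Real.sqrt_div' _ Real.pi_pos.le]
    field_simp
  have hα' : R * α = 1 / S := by
    rw [hα]
    field_simp
  have hR' : R * (1 / R - 1) = 1 - R := by
    field_simp
  rw [hint, hv t ht, hmat, main, ← hcoef, ← hα', hk_def]
  simp only [smul_add, smul_sub, smul_smul, hR', add_sub_cancel_right]
  module
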